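/- For every integer n ≥ 14, the Turán number of 2P₇ satisfies ex(n, 2P₇) = max{[n,14,7], 5n − 14}, where [n,14,7] = (5n + 91 + r(r−6))/2 with r the unique integer satisfying n − 13 ≡ r (mod 6) and 0 ≤ r < 6. -/

import Mathlib

open SimpleGraph

/-- `H` is contained in `G` as a subgraph, i.e. there is an injective graph
homomorphism from `H` to `G` (a copy of `H` in `G`). -/
def Contains {α β : Type*} (H : SimpleGraph α) (G : SimpleGraph β) : Prop :=
  ∃ f : H →g G, Function.Injective f

/-- `2P₇`: the disjoint union of two copies of the path on 7 vertices. -/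
def TwoP7 : SimpleGraph (Fin 7 ⊕ Fin 7) :=
  SimpleGraph.pathGraph 7 ⊕g SimpleGraph.pathGraph 7

/-- The quantity `[n, m, ℓ]` of the paper: writing `n = (m-1) + t(ℓ-1) + r` with
`t ≥ 0`, `0 ≤ r < ℓ-1`, it equals `C(m-1,2) + t·C(ℓ-1,2) + C(r,2)`;
if `n ≤ m-1` it equals `C(n,2)`. -/
def bracket (n m ℓ : ℕ) : ℕ :=
  if n ≤ m - 1 then n.choose 2
  else (m - 1).choose 2 + ((n - (m - 1)) / (ℓ - 1)) * (ℓ - 1).choose 2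
    + ((n - (m - 1)) % (ℓ - 1)).choose 2

set_option linter.unusedSectionVars false

section

variable {V : Type*} [DecidableEq V] {G : SimpleGraph V}

open Classical in
/-- The number of neighbours of `v` inside `U`. -/
noncomputable def degIn (G : SimpleGraph V) (U : Finset V) (v : V) : ℕ :=
  (U.filter fun w => G.Adj v w).card

/-- Twice the number of edges of `G` inside `U`. -/
noncomputable def degSum (G : SimpleGraph V) (U : Finset V) : ℕ :=
  ∑ u ∈ U, degIn G U u

open Classical in
theorem degIn_eq_sum (U : Finset V) (v : V) :
    degIn G U v = ∑ w ∈ U, if G.Adj v w then 1 else 0 := by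
  simp [degIn]

theorem degIn_mono {U W : Finset V} (h : U ⊆ W) (v : V) : degIn G U v ≤ degIn G W v := by
  classical
  exact Finset.card_le_card (Finset.filter_subset_filter _ h)

theorem degIn_le_of_le {K : SimpleGraph V} (h : G ≤ K) (U : Finset V) (v : V) :
    degIn G U v ≤ degIn K U v := by
  classical
  exact Finset.card_le_card (Finset.monotone_filter_right _ fun w _ hw => h hw)

theorem degIn_lt_card {U : Finset V} {v : V} (hv : v ∈ U) : degIn G U v < U.card := by
  classical
  refine Finset.card_lt_card (Finset.filter_ssubset.2 ⟨v, hv, by simp⟩)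

theorem degIn_union {A B : Finset V} (h : Disjoint A B) (v : V) :
    degIn G (A ∪ B) v = degIn G A v + degIn G B v := by
  classical
  simp only [degIn_eq_sum, Finset.sum_union h]

theorem degIn_insert {x : V} {S : Finset V} (hx : x ∉ S) (v : V) [Decidable (G.Adj v x)] :
    degIn G (insert x S) v = degIn G S v + if G.Adj v x then 1 else 0 := by
  classical
  simp only [degIn_eq_sum, Finset.sum_insert hx]
  split_ifs <;> omega

theorem degIn_insert_self {x : V} {S : Finset V} (hx : x ∉ S) :
    degIn G (insert x S) x = degIn G S x := by
  classical
  simp [degIn_insert hx]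

theorem degIn_pos {U : Finset V} {v : V} : 0 < degIn G U v ↔ ∃ w ∈ U, G.Adj v w := by
  classical
  simp [degIn, Finset.card_pos, Finset.Nonempty]

theorem degIn_eq_zero {U : Finset V} {v : V} (h : ∀ w ∈ U, ¬ G.Adj v w) : degIn G U v = 0 := by
  by_contra hne
  obtain ⟨w, hw, ha⟩ := degIn_pos.1 (Nat.pos_of_ne_zero hne)
  exact h w hw ha

theorem degIn_le_of_imp {U A : Finset V} {v : V} (h : ∀ w ∈ U, G.Adj v w → w ∈ A) :
    degIn G U v ≤ A.card := by
  classical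
  exact Finset.card_le_card fun w hw => by
    rw [Finset.mem_filter] at hw; exact h w hw.1 hw.2

theorem degIn_le_degIn_of_imp {U A : Finset V} {v : V} (h : ∀ w ∈ U, G.Adj v w → w ∈ A) :
    degIn G U v ≤ degIn G A v := by
  classical
  exact Finset.card_le_card fun w hw => by
    rw [Finset.mem_filter] at hw ⊢; exact ⟨h w hw.1 hw.2, hw.2⟩

theorem sum_degIn_comm (A B : Finset V) : ∑ a ∈ A, degIn G B a = ∑ b ∈ B, degIn G A b := by
  classical
  simp only [degIn_eq_sum]
  rw [Finset.sum_comm]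
  simp only [G.adj_comm]

theorem degSum_union {A B : Finset V} (h : Disjoint A B) :
    degSum G (A ∪ B) = degSum G A + degSum G B + 2 * ∑ b ∈ B, degIn G A b := by
  have := sum_degIn_comm (G := G) A B
  simp only [degSum, Finset.sum_union h, degIn_union h, Finset.sum_add_distrib]
  omega

theorem degSum_insert {x : V} {S : Finset V} (hx : x ∉ S) :
    degSum G (insert x S) = degSum G S + 2 * degIn G S x := by
  have h := degSum_union (G := G) (Finset.disjoint_singleton_right.2 hx)
  have h0 : degSum G {x} = 0 := by
    have := degIn_lt_card (G := G) (Finset.mem_singleton_self x)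
    simp [degSum] at this ⊢
    omega
  rw [Finset.union_comm, ← Finset.insert_eq] at h
  simp [h, h0]

theorem degSum_erase {x : V} {S : Finset V} (hx : x ∈ S) :
    degSum G S = degSum G (S.erase x) + 2 * degIn G S x := by
  have h := degSum_insert (G := G) (Finset.notMem_erase x S)
  have h' := degIn_insert_self (G := G) (Finset.notMem_erase x S)
  rw [Finset.insert_erase hx] at h h'
  omega

theorem degSum_le_card (U : Finset V) : degSum G U ≤ U.card * (U.card - 1) := by
  refine (Finset.sum_le_card_nsmul U _ (U.card - 1) fun u hu => ?_).trans (by simp)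
  have := degIn_lt_card (G := G) hu
  omega

/-- The list `l` traverses a path of `G`. -/
def IsPathList (G : SimpleGraph V) (l : List V) : Prop :=
  l.IsChain G.Adj ∧ l.Nodup

namespace IsPathList

theorem reverse {l : List V} (h : IsPathList G l) : IsPathList G l.reverse := by
  refine ⟨?_, by simpa using h.2⟩
  rw [List.isChain_reverse]
  exact h.1.imp fun a b hab => hab.symm

theorem take {l : List V} (h : IsPathList G l) (k : ℕ) : IsPathList G (l.take k) :=
  ⟨h.1.take k, h.2.sublist (List.take_sublist k l)⟩

theorem drop {l : List V} (h : IsPathList G l) (k : ℕ) : IsPathList G (l.drop k) :=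
  ⟨h.1.drop k, h.2.sublist (List.drop_sublist k l)⟩

theorem left {l m : List V} (h : IsPathList G (l ++ m)) : IsPathList G l := by
  simpa using h.take l.length

theorem right {l m : List V} (h : IsPathList G (l ++ m)) : IsPathList G m := by
  simpa using h.drop l.length

theorem card_toFinset {l : List V} (h : IsPathList G l) : l.toFinset.card = l.length :=
  List.toFinset_card_of_nodup h.2

theorem append {l m : List V} (hl : IsPathList G l) (hm : IsPathList G m)
    (hd : l.Disjoint m) (h : ∀ a ∈ l.getLast?, ∀ b ∈ m.head?, G.Adj a b) :
    IsPathList G (l ++ m) :=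
  ⟨List.isChain_append.2 ⟨hl.1, hm.1, h⟩, List.nodup_append'.2 ⟨hl.2, hm.2, hd⟩⟩

theorem singleton (x : V) : IsPathList G [x] := ⟨by simp, by simp⟩

theorem cons {x y : V} {l : List V} (h : IsPathList G (y :: l)) (hxy : G.Adj x y)
    (hx : x ∉ y :: l) : IsPathList G (x :: y :: l) :=
  ⟨List.isChain_cons_cons.2 ⟨hxy, h.1⟩, List.nodup_cons.2 ⟨hx, h.2⟩⟩

theorem mono {K : SimpleGraph V} {l : List V} (h : IsPathList G l) (hK : G ≤ K) :
    IsPathList K l :=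
  ⟨h.1.imp fun _ _ hab => hK hab, h.2⟩

end IsPathList

/-- The list `l` traverses a path of `G` whose last vertex is adjacent to its first one. -/
def IsCycleList (G : SimpleGraph V) (l : List V) : Prop :=
  IsPathList G l ∧ ∀ a ∈ l.getLast?, ∀ b ∈ l.head?, G.Adj a b

/-- Some cycle of `G` has vertex set `T`. -/
def IsHam (G : SimpleGraph V) (T : Finset V) : Prop :=
  ∃ l, IsCycleList G l ∧ l.toFinset = T

theorem IsCycleList.append_comm {l m : List V} (h : IsCycleList G (l ++ m)) :
    IsCycleList G (m ++ l) := by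
  obtain ⟨hp, hc⟩ := h
  rcases eq_or_ne l [] with rfl | hl
  · rw [List.append_nil]; exact ⟨hp, hc⟩
  rcases eq_or_ne m [] with rfl | hm
  · rw [List.append_nil] at hp hc; exact ⟨hp, hc⟩
  refine ⟨hp.right.append hp.left (List.nodup_append'.1 hp.2).2.2.symm ?_, ?_⟩
  · intro a ha b hb
    refine hc a ?_ b ?_
    · rw [List.getLast?_append_of_ne_nil _ hm]; exact ha
    · rw [List.head?_append_of_ne_nil _ hl]; exact hb
  · intro a ha b hb
    rw [List.getLast?_append_of_ne_nil _ hl] at ha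
    rw [List.head?_append_of_ne_nil _ hm] at hb
    exact (List.isChain_append.1 hp.1).2.2 a ha b hb

theorem IsCycleList.reverse {l : List V} (h : IsCycleList G l) : IsCycleList G l.reverse := by
  refine ⟨h.1.reverse, fun a ha b hb => (h.2 b ?_ a ?_).symm⟩
  · simpa using hb
  · simpa using ha

/-- A cycle through `v` may be traversed starting from `v`. -/
theorem IsCycleList.exists_cons {l : List V} (h : IsCycleList G l) {v : V} (hv : v ∈ l) :
    ∃ m, IsCycleList G (v :: m) ∧ (v :: m).toFinset = l.toFinset ∧
      (v :: m).length = l.length := by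
  obtain ⟨a, b, rfl⟩ := List.append_of_mem hv
  refine ⟨b ++ a, by simpa using h.append_comm, ?_, ?_⟩
  · ext x; simp; tauto
  · simp; omega

/-- `G` has no two disjoint paths with seven vertices each. -/
def NoTwoPaths (G : SimpleGraph V) : Prop :=
  ∀ l m : List V, IsPathList G l → IsPathList G m → l.Disjoint m →
    7 ≤ l.length → 7 ≤ m.length → False

theorem NoTwoPaths.length_lt (hG : NoTwoPaths G) {l : List V} (h : IsPathList G l) :
    l.length < 14 := by
  by_contra! hl
  have := h.2
  rw [← List.take_append_drop 7 l] at this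
  refine hG _ _ (h.take 7) (h.drop 7) (List.nodup_append'.1 this).2.2 ?_ ?_ <;> simp <;> omega

end

section

variable {V : Type*} [DecidableEq V] {G : SimpleGraph V}

open Classical in
/-- The positions on the list `l` occupied by neighbours of `w`. -/
noncomputable def nbrPos (G : SimpleGraph V) (l : List V) (w : V) : Finset ℕ :=
  (Finset.range l.length).filter fun i => ∃ h : i < l.length, G.Adj w l[i]

theorem mem_nbrPos {l : List V} {w : V} {i : ℕ} :
    i ∈ nbrPos G l w ↔ ∃ h : i < l.length, G.Adj w l[i] := by
  classical
  simp only [nbrPos, Finset.mem_filter, Finset.mem_range]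
  exact ⟨fun h => h.2, fun h => ⟨h.1, h⟩⟩

theorem card_nbrPos {l : List V} (hl : l.Nodup) (w : V) :
    (nbrPos G l w).card = degIn G l.toFinset w := by
  classical
  refine Finset.card_bij (fun i hi => l[i]'(mem_nbrPos.1 hi).1) ?_ ?_ ?_
  · intro i hi
    obtain ⟨h, ha⟩ := mem_nbrPos.1 hi
    simp [ha]
  · intro i hi j hj hij
    exact (hl.getElem_inj_iff).1 hij
  · intro b hb
    simp only [Finset.mem_filter, List.mem_toFinset] at hb
    obtain ⟨i, h, rfl⟩ := List.getElem_of_mem hb.1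
    exact ⟨i, mem_nbrPos.2 ⟨h, hb.2⟩, rfl⟩

theorem getLast?_cons_concat (u w : V) (m : List V) :
    (u :: (m ++ [w])).getLast? = some w := by
  rw [← List.cons_append, List.getLast?_concat]

theorem exists_longest {P : List V → Prop} {N : ℕ} (h : ∃ l, P l)
    (hN : ∀ l, P l → l.length ≤ N) : ∃ l, P l ∧ ∀ m, P m → m.length ≤ l.length := by
  classical
  obtain ⟨l, hl⟩ := h
  have hex : ∃ l, P l ∧ l.length = Nat.findGreatest (fun k => ∃ l, P l ∧ l.length = k) N :=
    Nat.findGreatest_spec (P := fun k => ∃ l, P l ∧ l.length = k) (hN l hl) ⟨l, hl, rfl⟩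
  obtain ⟨l', hl', he⟩ := hex
  refine ⟨l', hl', fun m hm => ?_⟩
  rw [he]
  exact Nat.le_findGreatest (hN m hm) ⟨m, hm, rfl⟩

/-- If the end vertices `u`, `v` of a path have a pair of crossing chords, then the vertices
of the path span a cycle. -/
theorem IsPathList.isHam_of_cross {l : List V} (hl : IsPathList G l) {i : ℕ}
    (hi : i + 1 < l.length) (hu : G.Adj (l[0]'(by omega)) l[i + 1])
    (hv : G.Adj (l[l.length - 1]'(by omega)) l[i]) : IsHam G l.toFinset := by
  have hd := hl.2
  rw [← List.take_append_drop (i + 1) l] at hd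
  have hd := (List.nodup_append'.1 hd).2.2
  refine ⟨l.take (i + 1) ++ (l.drop (i + 1)).reverse,
    ⟨(hl.take _).append (hl.drop _).reverse (by simpa using hd) ?_, ?_⟩, ?_⟩
  · intro a ha b hb
    rw [List.head?_reverse, List.getLast?_drop, if_neg (by omega), List.getLast?_eq_getElem?,
      List.getElem?_eq_getElem (by omega)] at hb
    rw [List.getLast?_take, if_neg (by omega)] at ha
    simp only [Nat.add_sub_cancel, List.getElem?_eq_getElem (show i < l.length by omega)] at ha
    simp at ha hb
    rw [← ha, ← hb]
    exact hv.symm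
  · intro a ha b hb
    rw [List.getLast?_append_of_ne_nil _ (by simp; omega), List.getLast?_reverse,
      List.head?_drop, List.getElem?_eq_getElem hi] at ha
    rw [List.head?_append_of_ne_nil _ (by simp; rintro rfl; simp at hi), List.head?_take,
      if_neg (by omega), List.head?_eq_getElem?,
      List.getElem?_eq_getElem (by omega)] at hb
    simp at ha hb
    rw [← ha, ← hb]
    exact hu.symm
  · ext x
    simp only [List.mem_toFinset, List.mem_append, List.mem_reverse]
    rw [← List.mem_append, List.take_append_drop]

/-- If the degrees of the end vertices of a path inside the path add up to the number of its
vertices, then the vertices of the path span a cycle. -/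
theorem IsPathList.isHam {l : List V} (hl : IsPathList G l) (h0 : 0 < l.length)
    (h : l.length ≤ degIn G l.toFinset l[0] + degIn G l.toFinset (l[l.length - 1])) :
    IsHam G l.toFinset := by
  rw [← card_nbrPos hl.2, ← card_nbrPos hl.2] at h
  set A := nbrPos G l l[0]
  set B := nbrPos G l l[l.length - 1]
  have hA : A ⊆ (Finset.range (l.length - 1)).image (· + 1) := by
    intro i hi
    obtain ⟨h1, h2⟩ := mem_nbrPos.1 hi
    have : i ≠ 0 := by rintro rfl; exact G.loopless.irrefl _ h2
    simp only [Finset.mem_image, Finset.mem_range]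
    exact ⟨i - 1, by omega, by omega⟩
  have hB : B.image (· + 1) ⊆ (Finset.range (l.length - 1)).image (· + 1) := by
    refine Finset.image_subset_image fun i hi => ?_
    obtain ⟨h1, h2⟩ := mem_nbrPos.1 hi
    have : i ≠ l.length - 1 := by rintro rfl; exact G.loopless.irrefl _ h2
    simp only [Finset.mem_range]
    omega
  have hBc : (B.image (· + 1)).card = B.card :=
    Finset.card_image_of_injective _ (add_left_injective 1)
  have hc : ((Finset.range (l.length - 1)).image (· + 1)).card ≤ l.length - 1 :=
    Finset.card_image_le.trans (by simp)
  obtain ⟨j, hj⟩ : (A ∩ B.image (· + 1)).Nonempty := by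
    rw [← Finset.card_pos]
    have h1 := Finset.card_union_add_card_inter A (B.image (· + 1))
    have h2 := Finset.card_le_card (Finset.union_subset hA hB)
    omega
  simp only [Finset.mem_inter, Finset.mem_image] at hj
  obtain ⟨hjA, i, hiB, rfl⟩ := hj
  obtain ⟨h1, h2⟩ := mem_nbrPos.1 hjA
  obtain ⟨h3, h4⟩ := mem_nbrPos.1 hiB
  exact hl.isHam_of_cross h1 h2 h4

theorem IsPathList.isHam_of_concat {u v : V} {m : List V} (hl : IsPathList G (u :: m ++ [v]))
    (h : (u :: m ++ [v]).length ≤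
      degIn G (u :: m ++ [v]).toFinset u + degIn G (u :: m ++ [v]).toFinset v) :
    IsHam G (u :: m ++ [v]).toFinset := by
  refine hl.isHam (by simp) ?_
  have h1 : (u :: m ++ [v])[(u :: m ++ [v]).length - 1] = v := by simp
  have h0 : (u :: m ++ [v])[0] = u := by simp
  simp only [h0, h1]
  exact h

theorem isChain_of_notMem {u v : V} {m : List V}
    (h : m.IsChain (G ⊔ edge u v).Adj) (hu : u ∉ m) : m.IsChain G.Adj := by
  refine (List.isChain_iff_forall_rel_of_append_cons_cons.2 ?_)
  rintro a b l₁ l₂ rfl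
  have := (List.isChain_iff_forall_rel_of_append_cons_cons.1 h) (a := a) (b := b) rfl
  rw [sup_adj, edge_adj] at this
  rcases this with h | ⟨(⟨rfl, rfl⟩ | ⟨rfl, rfl⟩), h⟩
  · exact h
  · simp at hu
  · simp at hu

theorem IsHam.of_sup_edge {T : Finset V} (hT : 3 ≤ T.card) {u v : V} (hu : u ∈ T)
    (huv : T.card ≤ degIn G T u + degIn G T v) (h : IsHam (G ⊔ edge u v) T) : IsHam G T := by
  obtain ⟨l, hl, rfl⟩ := h
  obtain ⟨m, hm, hme, -⟩ := hl.exists_cons (List.mem_toFinset.1 hu)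
  rw [← hme] at huv hT ⊢
  clear hme hl hu l
  have key : ∀ m : List V, IsCycleList (G ⊔ edge u v) (u :: m) → m.head? ≠ some v →
      (u :: m).toFinset.card ≤ degIn G (u :: m).toFinset u + degIn G (u :: m).toFinset v →
      3 ≤ (u :: m).toFinset.card → IsHam G (u :: m).toFinset := by
    intro m hm hhead hdeg hT
    have hum : u ∉ m := (List.nodup_cons.1 hm.1.2).1
    have hpath : IsPathList G (u :: m) := by
      refine ⟨?_, hm.1.2⟩
      have hc := isChain_of_notMem (hm.1.1.tail) (by simpa using hum)
      rcases m with _ | ⟨b, m⟩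
      · simp
      · refine List.isChain_cons_cons.2 ⟨?_, hc⟩
        have := (List.isChain_cons_cons.1 hm.1.1).1
        rw [sup_adj, edge_adj] at this
        rcases this with h | ⟨(⟨-, rfl⟩ | ⟨rfl, rfl⟩), h⟩
        · exact h
        · simp at hhead
        · simp at h
    rcases List.eq_nil_or_concat m with rfl | ⟨m, w, rfl⟩
    · simp at hT
    rw [List.concat_eq_append] at *
    by_cases hw : w = v
    · subst hw
      refine IsPathList.isHam_of_concat (m := m) (by simpa using hpath) ?_
      rw [hpath.card_toFinset] at hdeg
      simpa using hdeg
    · refine ⟨_, ⟨hpath, ?_⟩, rfl⟩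
      have := hm.2 w (by simp [getLast?_cons_concat]) u (by simp)
      rw [sup_adj, edge_adj] at this
      have hwu : w ≠ u := by rintro rfl; simp at hum
      rcases this with h | ⟨(⟨h, -⟩ | ⟨h, -⟩), -⟩
      · intro a ha b hb
        simp [getLast?_cons_concat] at ha hb
        subst ha hb
        exact h
      · exact absurd h hwu
      · exact absurd h hw
  by_cases hhead : m.head? = some v
  · have hrev : (u :: m.reverse).toFinset = (u :: m).toFinset := by ext x; simp
    have h2 : IsCycleList (G ⊔ edge u v) (u :: m.reverse) := by
      have := hm.reverse
      rw [List.reverse_cons] at this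
      simpa using this.append_comm
    rw [← hrev] at huv hT ⊢
    refine key _ h2 ?_ huv hT
    intro hlast
    rcases m with _ | ⟨a, m⟩
    · simp at hhead
    · rcases List.eq_nil_or_concat m with rfl | ⟨m, w, rfl⟩
      · have := List.toFinset_card_le [u, a]
        simp only [List.reverse_cons, List.reverse_nil, List.nil_append] at hT
        simp only [List.length_cons, List.length_nil] at this
        omega
      · simp at hhead hlast
        have := hm.1.2
        simp [hhead, hlast] at this
  · exact key m hm hhead huv hT

theorem exists_closure [Finite V] {T : Finset V} (hT : 3 ≤ T.card) (h : ¬ IsHam G T) :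
    ∃ K : SimpleGraph V, G ≤ K ∧ ¬ IsHam K T ∧
      ∀ u ∈ T, ∀ v ∈ T, u ≠ v → T.card ≤ degIn K T u + degIn K T v → K.Adj u v := by
  obtain ⟨K, hGK, hK⟩ :=
    (Set.toFinite {K : SimpleGraph V | ¬ IsHam K T}).exists_le_maximal (a := G) h
  refine ⟨K, hGK, hK.prop, fun u hu v hv huv hd => ?_⟩
  by_contra hadj
  refine hadj ?_
  have hnot : IsHam (K ⊔ edge u v) T → False := fun hh => hK.prop (hh.of_sup_edge hT hu hd)
  have := hK.le_of_ge (y := K ⊔ edge u v) hnot le_sup_left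
  exact this (by rw [sup_adj, edge_adj]; exact Or.inr ⟨Or.inl ⟨rfl, rfl⟩, huv⟩)

theorem isHam_of_clique {T : Finset V} (hT : 2 ≤ T.card)
    (h : ∀ u ∈ T, ∀ v ∈ T, u ≠ v → G.Adj u v) : IsHam G T := by
  refine ⟨T.toList, ⟨⟨?_, T.nodup_toList⟩, ?_⟩, by simp⟩
  · refine List.Pairwise.isChain ?_
    refine (List.Pairwise.imp_of_mem ?_ T.nodup_toList)
    intro a b ha hb hab
    exact h a (by simpa using ha) b (by simpa using hb) hab
  · intro a ha b hb
    refine h a (by simpa using List.mem_of_getLast? ha) b (by simpa using List.mem_of_head? hb) ?_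
    rintro rfl
    have hlen : 2 ≤ T.toList.length := by simpa using hT
    have hn := T.nodup_toList
    rcases hl : T.toList with _ | ⟨c, m⟩
    · simp [hl] at hlen
    · rcases List.eq_nil_or_concat m with rfl | ⟨m, w, rfl⟩
      · simp [hl] at hlen
      · rw [hl] at ha hb hn
        simp [getLast?_cons_concat] at ha hb
        subst ha hb
        simp at hn

/-- A criterion for the existence of a spanning cycle: the vertices of `T` can be added one by
one to the dense set `H` in the Bondy-Chvátal closure. -/
theorem isHam_of_core [Finite V] {H T : Finset V} (hT : 3 ≤ T.card) (hHT : H ⊆ T)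
    (hH : ∀ v ∈ H, T.card ≤ 2 * degIn G H v)
    (hgrow : ∀ S, H ⊆ S → S ⊂ T → ∃ x ∈ T, x ∉ S ∧ T.card + 1 ≤ degIn G T x + S.card) :
    IsHam G T := by
  by_contra hham
  obtain ⟨K, hGK, hK, hcl⟩ := exists_closure hT hham
  let good : Set (Finset V) :=
    {S | H ⊆ S ∧ S ⊆ T ∧ ∀ u ∈ S, ∀ v ∈ S, u ≠ v → K.Adj u v}
  have hHgood : H ∈ good := by
    refine ⟨subset_rfl, hHT, fun u hu v hv huv => hcl u (hHT hu) v (hHT hv) huv ?_⟩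
    have := hH u hu
    have := hH v hv
    have := (degIn_le_of_le hGK H u).trans (degIn_mono hHT u)
    have := (degIn_le_of_le hGK H v).trans (degIn_mono hHT v)
    omega
  obtain ⟨S, hHS, hS⟩ := (Set.toFinite good).exists_le_maximal hHgood
  obtain ⟨h1, h2, h3⟩ := hS.prop
  rcases eq_or_ne S T with rfl | hne
  · exact hK (isHam_of_clique (by omega) h3)
  obtain ⟨x, hxT, hxS, hx⟩ := hgrow S h1 (h2.ssubset_of_ne hne)
  have hadj : ∀ s ∈ S, K.Adj x s := by
    intro s hs
    refine hcl x hxT s (h2 hs) (by rintro rfl; exact hxS hs) ?_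
    have e1 := degIn_le_of_le hGK T x
    have e2 : (S.erase s).card ≤ degIn K T s := by
      classical
      refine Finset.card_le_card fun w hw => ?_
      rw [Finset.mem_erase] at hw
      rw [Finset.mem_filter]
      exact ⟨h2 hw.2, h3 s hs w hw.2 hw.1.symm⟩
    rw [Finset.card_erase_of_mem hs] at e2
    omega
  have hins : insert x S ∈ good := by
    refine ⟨h1.trans (Finset.subset_insert _ _), Finset.insert_subset hxT h2, ?_⟩
    intro u hu v hv huv
    rw [Finset.mem_insert] at hu hv
    rcases hu with rfl | hu <;> rcases hv with rfl | hv
    · exact absurd rfl huv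
    · exact hadj v hv
    · exact (hadj u hu).symm
    · exact h3 u hu v hv huv
  exact hxS (hS.le_of_ge hins (Finset.subset_insert _ _) (Finset.mem_insert_self x S))

end

section

variable {V : Type*} [DecidableEq V] {G : SimpleGraph V}

theorem IsPathList.length_le {l : List V} (h : IsPathList G l) {U : Finset V}
    (hU : ∀ x ∈ l, x ∈ U) : l.length ≤ U.card := by
  rw [← h.card_toFinset]
  exact Finset.card_le_card fun x hx => hU x (List.mem_toFinset.1 hx)

/-- A path leaving a cycle can be continued around the whole cycle. -/
theorem IsHam.exists_append {T : Finset V} (hT : IsHam G T) {x y : V} {q : List V} (hx : x ∈ T)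
    (hq : IsPathList G (y :: q)) (hqT : ∀ z ∈ y :: q, z ∉ T) (hyx : G.Adj y x) :
    ∃ m, IsPathList G ((y :: q).reverse ++ x :: m) ∧ (x :: m).toFinset = T ∧
      (x :: m).length = T.card := by
  obtain ⟨l, hl, rfl⟩ := hT
  obtain ⟨m, hm, hmT, hlen⟩ := hl.exists_cons (List.mem_toFinset.1 hx)
  refine ⟨m, hq.reverse.append hm.1 ?_ ?_, hmT, by rw [hlen, hl.1.card_toFinset]⟩
  · intro z hz hz'
    refine hqT z (List.mem_reverse.1 hz) ?_
    rw [← hmT]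
    exact List.mem_toFinset.2 hz'
  · intro a ha b hb
    simp at ha hb
    subst ha hb
    exact hyx

theorem exists_long_path_or_closed_cycle {H : Finset V} (hne : H.Nonempty) {d : ℕ}
    (hdeg : ∀ v ∈ H, d ≤ degIn G H v) :
    (∃ l, IsPathList G l ∧ (∀ x ∈ l, x ∈ H) ∧ 2 * d + 1 ≤ l.length) ∨
    ∃ T ⊆ H, IsHam G T ∧ d + 1 ≤ T.card ∧ T.card ≤ 2 * d ∧
      ∀ x ∈ T, ∀ y ∈ H, y ∉ T → ¬ G.Adj x y := by
  obtain ⟨v, hv⟩ := hne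
  obtain ⟨l, ⟨hl, hlH⟩, hmax⟩ := exists_longest
    (P := fun l : List V => IsPathList G l ∧ ∀ x ∈ l, x ∈ H) (N := H.card)
    ⟨[v], IsPathList.singleton v, by simpa using hv⟩ fun l hl => hl.1.length_le hl.2
  have hpos : 0 < l.length := by
    have := hmax [v] ⟨IsPathList.singleton v, by simpa using hv⟩
    simp at this; omega
  have hfirst : ∀ l : List V, IsPathList G l → (∀ x ∈ l, x ∈ H) →
      (∀ m : List V, (IsPathList G m ∧ ∀ x ∈ m, x ∈ H) → m.length ≤ l.length) →
      ∀ (h : 0 < l.length), d ≤ degIn G l.toFinset l[0] := by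
    intro l hl hlH hmax h
    refine (hdeg _ (hlH _ (List.getElem_mem h))).trans (degIn_le_degIn_of_imp fun w hw ha => ?_)
    by_contra hwl
    rcases l with _ | ⟨u, l⟩
    · simp at h
    have := hmax (w :: u :: l) ⟨hl.cons ha.symm (by simpa using hwl), ?_⟩
    · simp at this
    · intro x hx
      rcases List.mem_cons.1 hx with rfl | hx
      · exact hw
      · exact hlH x hx
  have h0 := hfirst l hl hlH hmax hpos
  have h1 := hfirst l.reverse hl.reverse (by simpa using hlH) (by simpa using hmax)
    (by simpa using hpos)
  simp only [List.toFinset_reverse, List.getElem_reverse] at h1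
  by_cases hlen : 2 * d + 1 ≤ l.length
  · exact Or.inl ⟨l, hl, hlH, hlen⟩
  right
  have hham : IsHam G l.toFinset := hl.isHam hpos (by simp at h1; omega)
  have hc := hl.card_toFinset
  have hlow : degIn G l.toFinset l[0] < l.toFinset.card :=
    degIn_lt_card (List.mem_toFinset.2 (List.getElem_mem hpos))
  refine ⟨l.toFinset, fun x hx => hlH x (List.mem_toFinset.1 hx), hham, by omega, by omega, ?_⟩
  intro x hx y hy hyT hxy
  obtain ⟨m, hm, hmT, hlm⟩ := hham.exists_append hx (q := []) (IsPathList.singleton y)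
    (by simpa using hyT) hxy.symm
  have := hmax _ ⟨hm, fun z hz => ?_⟩
  · simp at this hlm; omega
  · rw [List.mem_append] at hz
    rcases hz with hz | hz
    · simp at hz; subst hz; exact hy
    · rw [← List.mem_toFinset, hmT, List.mem_toFinset] at hz
      exact hlH z hz

theorem degSum_sdiff_of_closed {T U : Finset V} (hT : T ⊆ U)
    (h : ∀ x ∈ T, ∀ y ∈ U, y ∉ T → ¬ G.Adj x y) :
    degSum G U = degSum G T + degSum G (U \ T) := by
  have h1 := degSum_union (G := G) (Finset.disjoint_sdiff (s := T) (t := U))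
  rw [Finset.union_sdiff_of_subset hT, Finset.sum_eq_zero] at h1
  · simpa using h1
  · intro b hb
    rw [Finset.mem_sdiff] at hb
    exact degIn_eq_zero fun w hw ha => h w hw b hb.1 hb.2 ha.symm

/-- Twice the number of edges of the disjoint union of copies of `K₆` and one smaller complete
graph on `b` vertices in total. -/
def sixBlocks (b : ℕ) : ℕ := 30 * (b / 6) + b % 6 * (b % 6 - 1)

theorem degSum_le_four_mul {U : Finset V} (hP : ∀ l, IsPathList G l → (∀ x ∈ l, x ∈ U) →
    l.length < 7) (hC : ∀ T ⊆ U, T.card = 6 → ¬ IsHam G T) :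
    ∀ (k : ℕ) (H : Finset V), H ⊆ U → H.card = k → degSum G H ≤ 4 * k := by
  intro k
  induction k using Nat.strong_induction_on with
  | _ k ih =>
    intro H hHU hk
    rcases H.eq_empty_or_nonempty with rfl | hne
    · simp [degSum]
    by_cases hlow : ∃ v ∈ H, degIn G H v ≤ 2
    · obtain ⟨v, hv, hd⟩ := hlow
      have hpos := Finset.card_pos.2 hne
      have h1 := ih (k - 1) (by omega) (H.erase v) ((Finset.erase_subset v H).trans hHU)
        (by rw [Finset.card_erase_of_mem hv, hk])
      have h2 := degSum_erase (G := G) hv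
      omega
    push Not at hlow
    rcases exists_long_path_or_closed_cycle hne (d := 3) hlow with
      ⟨l, hl, hlH, hlen⟩ | ⟨T, hTH, hT, h4, h6, hcl⟩
    · have := hP l hl fun x hx => hHU (hlH x hx)
      omega
    · have h5 : T.card ≠ 6 := fun h => hC T (hTH.trans hHU) h hT
      have h1 := degSum_sdiff_of_closed hTH hcl
      have h2 := Finset.card_sdiff_of_subset hTH
      have h3 := Finset.card_le_card hTH
      have h7 := ih (k - T.card) (by omega) (H \ T) (Finset.sdiff_subset.trans hHU) (by omega)
      have h8 := degSum_le_card (G := G) T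
      have h9 : T.card * (T.card - 1) ≤ T.card * 4 := Nat.mul_le_mul_left _ (by omega)
      omega

/-- The bound on the number of edges of a graph without a path on seven vertices. -/
theorem degSum_le_sixBlocks (k : ℕ) (U : Finset V) (hk : U.card = k)
    (hP : ∀ l, IsPathList G l → (∀ x ∈ l, x ∈ U) → l.length < 7) :
    degSum G U ≤ sixBlocks k := by
  induction k using Nat.strong_induction_on generalizing U with
  | _ k ih =>
    rcases Nat.lt_or_ge k 7 with h7 | h7
    · refine (degSum_le_card U).trans ?_
      rw [hk]
      interval_cases k <;> decide
    by_cases hC : ∃ T ⊆ U, T.card = 6 ∧ IsHam G T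
    · obtain ⟨T, hTU, h6, hT⟩ := hC
      have hcl : ∀ x ∈ T, ∀ y ∈ U, y ∉ T → ¬ G.Adj x y := by
        intro x hx y hy hyT hxy
        obtain ⟨m, hm, hmT, hlm⟩ := hT.exists_append hx (q := []) (IsPathList.singleton y)
          (by simpa using hyT) hxy.symm
        have := hP _ hm fun z hz => ?_
        · simp at this hlm; omega
        · rw [List.mem_append] at hz
          rcases hz with hz | hz
          · simp at hz; subst hz; exact hy
          · rw [← List.mem_toFinset, hmT] at hz
            exact hTU hz
      have h1 := degSum_sdiff_of_closed hTU hcl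
      have h2 := Finset.card_sdiff_of_subset hTU
      have h3 := ih (k - 6) (by omega) (U \ T) (by omega)
        fun l hl hlU => hP l hl fun x hx => (Finset.mem_sdiff.1 (hlU x hx)).1
      have h4 := degSum_le_card (G := G) T
      rw [h6] at h4
      have h5 : sixBlocks k = 30 + sixBlocks (k - 6) := by
        unfold sixBlocks
        have e1 : (k - 6) % 6 = k % 6 := by omega
        have e2 : k / 6 = (k - 6) / 6 + 1 := by omega
        rw [e1, e2]; ring
      omega
    · push Not at hC
      have h1 := degSum_le_four_mul hP (fun T hT h6 => hC T hT h6) k U subset_rfl hk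
      refine h1.trans ?_
      unfold sixBlocks
      have h2 := Nat.mod_lt k (show 6 > 0 by norm_num)
      have h3 := Nat.div_add_mod k 6
      generalize k % 6 = r at *
      generalize k / 6 = t at *
      interval_cases r <;> omega

/-- `H` is a maximal subset of `U` all of whose vertices have at least six neighbours in it. -/
structure IsCore (G : SimpleGraph V) (U H : Finset V) : Prop where
  subset : H ⊆ U
  six_le : ∀ v ∈ H, 6 ≤ degIn G H v
  exists_le : ∀ S, H ⊂ S → S ⊆ U → ∃ v ∈ S, v ∉ H ∧ degIn G S v ≤ 5

theorem exists_isCore (U : Finset V) : ∃ H, IsCore G U H := by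
  have hfin : {H : Finset V | H ⊆ U ∧ ∀ v ∈ H, 6 ≤ degIn G H v}.Finite :=
    (U.powerset.finite_toSet).subset fun H hH => by simpa using hH.1
  obtain ⟨H, -, hH⟩ := hfin.exists_le_maximal (a := ∅) (by simp)
  refine ⟨H, hH.prop.1, hH.prop.2, fun S hHS hSU => ?_⟩
  by_contra! hS
  refine hHS.2 (hH.le_of_ge (y := S) ⟨hSU, fun v hv => ?_⟩ hHS.1)
  by_cases hvH : v ∈ H
  · exact (hH.prop.2 v hvH).trans (degIn_mono hHS.1 v)
  · exact hS v hv hvH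

theorem IsCore.exists_subset {U H : Finset V} (h : IsCore G U H) (k : ℕ) :
    ∀ W, H ⊆ W → W ⊆ U → W.card = H.card + k → ∀ j ≤ k,
      ∃ S, H ⊆ S ∧ S ⊆ W ∧ S.card = H.card + j ∧ degSum G W ≤ degSum G S + 10 * (k - j) := by
  induction k with
  | zero =>
    intro W hHW hWU hc j hj
    exact ⟨W, hHW, subset_rfl, by omega, by omega⟩
  | succ k ih =>
    intro W hHW hWU hc j hj
    rcases Nat.lt_or_ge k j with hkj | hkj
    · exact ⟨W, hHW, subset_rfl, by omega, by omega⟩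
    have hne : H ≠ W := by rintro rfl; omega
    obtain ⟨v, hvW, hvH, hd⟩ := h.exists_le W (hHW.ssubset_of_ne hne) hWU
    have hsub : H ⊆ W.erase v := fun x hx =>
      Finset.mem_erase.2 ⟨by rintro rfl; exact hvH hx, hHW hx⟩
    obtain ⟨S, h1, h2, h3, h4⟩ := ih (W.erase v) hsub ((Finset.erase_subset v W).trans hWU)
      (by rw [Finset.card_erase_of_mem hvW]; omega) j hkj
    refine ⟨S, h1, h2.trans (Finset.erase_subset v W), h3, ?_⟩
    have := degSum_erase (G := G) hvW
    omega

theorem IsCore.exists_card {U H : Finset V} (h : IsCore G U H) {m : ℕ} (h1 : H.card ≤ m)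
    (h2 : m ≤ U.card) :
    ∃ S, H ⊆ S ∧ S ⊆ U ∧ S.card = m ∧ degSum G U ≤ degSum G S + 10 * (U.card - m) := by
  obtain ⟨S, e1, e2, e3, e4⟩ := h.exists_subset (U.card - H.card) U h.subset subset_rfl
    (by omega) (m - H.card) (by omega)
  exact ⟨S, e1, e2, by omega, by omega⟩

theorem IsCore.degSum_le {U H S : Finset V} (h : IsCore G U H) (h1 : H ⊆ S) (h2 : S ⊆ U) :
    degSum G S ≤ degSum G H + 10 * (S.card - H.card) := by
  have hc := Finset.card_le_card h1
  obtain ⟨S', e1, e2, e3, e4⟩ := h.exists_subset (S.card - H.card) S h1 h2 (by omega) 0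
    (by omega)
  rw [Finset.eq_of_subset_of_card_le e1 (by omega)]
  omega

end

section

variable {V : Type*} [DecidableEq V] {G : SimpleGraph V}

/-- `c` runs periodically around a cycle on twelve vertices. -/
structure IsTwelveCycle (G : SimpleGraph V) (c : ℕ → V) : Prop where
  adj : ∀ k, G.Adj (c k) (c (k + 1))
  eq_iff : ∀ a b, c a = c b ↔ a % 12 = b % 12

theorem IsTwelveCycle.shift {c : ℕ → V} (h : IsTwelveCycle G c) (j : ℕ) :
    IsTwelveCycle G fun k => c (k + j) := by
  refine ⟨fun k => ?_, fun a b => ?_⟩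
  · have := h.adj (k + j)
    rwa [show k + j + 1 = k + 1 + j by ring] at this
  · rw [h.eq_iff]; omega

theorem IsTwelveCycle.mod {c : ℕ → V} (h : IsTwelveCycle G c) (k : ℕ) : c (k % 12) = c k := by
  rw [h.eq_iff]; omega

theorem IsHam.exists_isTwelveCycle {T : Finset V} (hT : IsHam G T) (hc : T.card = 12) :
    ∃ c, IsTwelveCycle G c ∧ T = (Finset.range 12).image c := by
  obtain ⟨l, ⟨hl, hcl⟩, rfl⟩ := hT
  rw [hl.card_toFinset] at hc
  have hlt : ∀ k, k % 12 < l.length := fun k => by omega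
  refine ⟨fun k => l[k % 12]'(hlt k), ⟨fun k => ?_, fun a b => ?_⟩, ?_⟩
  · rcases eq_or_ne (k % 12) 11 with h | h
    · refine hcl _ ?_ _ ?_
      · rw [List.getLast?_eq_getElem?]
        simp [hc, h]
      · rw [List.head?_eq_getElem?]
        simp [show (k + 1) % 12 = 0 by omega]
    · have h1 : (k + 1) % 12 = k % 12 + 1 := by omega
      have := List.isChain_iff_getElem.1 hl.1 (k % 12) (by omega)
      simpa [h1] using this
  · rw [hl.2.getElem_inj_iff]
  · ext v
    simp only [List.mem_toFinset, Finset.mem_image, Finset.mem_range]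
    constructor
    · intro hv
      obtain ⟨i, hi, rfl⟩ := List.getElem_of_mem hv
      exact ⟨i, by omega, by simp [Nat.mod_eq_of_lt (show i < 12 by omega)]⟩
    · rintro ⟨i, -, rfl⟩
      exact List.getElem_mem _

/-- Adjacency in a twelve-cycle on the numbers below `12` with the extra edges `ex`. -/
def cycleAdj (ex : List (ℕ × ℕ)) (a b : ℕ) : Bool :=
  (a < 12 && b < 12 && ((a + 1) % 12 == b || (b + 1) % 12 == a)) ||
    ex.contains (a, b) || ex.contains (b, a)

/-- A Boolean test for `l` being a path of the graph `cycleAdj ex`. -/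
def chainTest (ex : List (ℕ × ℕ)) : List ℕ → Bool
  | [] => true
  | [_] => true
  | a :: b :: l => cycleAdj ex a b && chainTest ex (b :: l)

/-- A Boolean test for `p` and `q` being two disjoint paths on seven vertices each. -/
def twoPathsTest (ex : List (ℕ × ℕ)) (p q : List ℕ) : Bool :=
  chainTest ex p && chainTest ex q && decide (p ++ q).Nodup && (p ++ q).all (· < 14) &&
    p.length == 7 && q.length == 7

theorem isChain_of_chainTest {ex : List (ℕ × ℕ)} :
    ∀ {l : List ℕ}, chainTest ex l → l.IsChain fun a b => cycleAdj ex a b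
  | [], _ => by simp
  | [_], _ => by simp
  | a :: b :: l, h => by
    simp only [chainTest, Bool.and_eq_true] at h
    exact List.isChain_cons_cons.2 ⟨h.1, isChain_of_chainTest h.2⟩

/-- The vertices of a twelve-cycle, followed by the two further vertices `x` and `y`. -/
def cyclePoint (c : ℕ → V) (x y : V) (a : ℕ) : V :=
  if a < 12 then c a else if a = 12 then x else y

theorem IsTwelveCycle.not_twoPathsTest (hG : NoTwoPaths G) {c : ℕ → V} (hc : IsTwelveCycle G c)
    {x y : V} (hxy : x ≠ y) (hx : ∀ k, x ≠ c k) (hy : ∀ k, y ≠ c k) {ex : List (ℕ × ℕ)}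
    (hex : ∀ e ∈ ex, G.Adj (cyclePoint c x y e.1) (cyclePoint c x y e.2)) {p q : List ℕ}
    (h : twoPathsTest ex p q = true) : False := by
  simp only [twoPathsTest, Bool.and_eq_true, decide_eq_true_eq, List.all_eq_true,
    beq_iff_eq] at h
  obtain ⟨⟨⟨⟨⟨hp, hq⟩, hnd⟩, hlt⟩, h7⟩, h7'⟩ := h
  set f := cyclePoint c x y with hf
  have hinj : ∀ a < 14, ∀ b < 14, f a = f b → a = b := by
    intro a ha b hb hab
    simp only [hf, cyclePoint] at hab
    split_ifs at hab with h1 h2 h3 h4 h5 h6 h7 h8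
    · rw [hc.eq_iff] at hab; omega
    · exact absurd hab.symm (hx a)
    · exact absurd hab.symm (hy a)
    · exact absurd hab (hx b)
    · omega
    · exact absurd hab hxy
    · exact absurd hab (hy b)
    · exact absurd hab.symm hxy
    · omega
  have hadj : ∀ a b, cycleAdj ex a b → G.Adj (f a) (f b) := by
    intro a b hab
    simp only [cycleAdj, Bool.or_eq_true, Bool.and_eq_true, decide_eq_true_eq, beq_iff_eq,
      List.contains_eq_mem] at hab
    rcases hab with (⟨⟨ha, hb⟩, h | h⟩ | h) | h
    · have := hc.adj a
      rw [← hc.mod (a + 1), h] at this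
      simpa [hf, cyclePoint, ha, hb] using this
    · have := hc.adj b
      rw [← hc.mod (b + 1), h] at this
      simpa [hf, cyclePoint, ha, hb] using this.symm
    · exact hex _ h
    · exact (hex _ h).symm
  have hpath : ∀ l : List ℕ, chainTest ex l → l.Nodup → (∀ a ∈ l, a < 14) →
      IsPathList G (l.map f) := by
    intro l hl hn hl14
    refine ⟨?_, ?_⟩
    · rw [List.isChain_map]
      exact (isChain_of_chainTest hl).imp hadj
    · exact List.Nodup.map_on (fun a ha b hb => hinj a (hl14 a ha) b (hl14 b hb)) hn
  obtain ⟨hn1, hn2, hd⟩ := List.nodup_append'.1 hnd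
  have hlt1 : ∀ a ∈ p, a < 14 := fun a ha => by simpa using hlt a (by simp [ha])
  have hlt2 : ∀ a ∈ q, a < 14 := fun a ha => by simpa using hlt a (by simp [ha])
  refine hG (p.map f) (q.map f) (hpath p hp hn1 hlt1) (hpath q hq hn2 hlt2) ?_
    (by simp [h7]) (by simp [h7'])
  intro v hv hv'
  obtain ⟨a, ha, rfl⟩ := List.mem_map.1 hv
  obtain ⟨b, hb, hab⟩ := List.mem_map.1 hv'
  obtain rfl := hinj _ (hlt2 b hb) _ (hlt1 a ha) hab
  exact hd ha hb

/-- The positions on the cycle that two outside vertices may have relative to each other. -/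
def farPos : Finset ℕ := {0, 2, 3, 5, 7, 9, 10}

section

variable {c : ℕ → V} {x y : V}

theorem IsTwelveCycle.mem_farPos (hG : NoTwoPaths G) (hc : IsTwelveCycle G c) (hxy : x ≠ y)
    (hx : ∀ k, x ≠ c k) (hy : ∀ k, y ≠ c k) (h0 : G.Adj y (c 0)) {i : ℕ} (hi : i < 12)
    (h : G.Adj x (c i)) : i ∈ farPos := by
  have key : ∀ p q, twoPathsTest [(12, i), (13, 0)] p q = true → False := fun p q =>
    hc.not_twoPathsTest hG hxy hx hy (by simp [cyclePoint, hi, h, h0])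
  by_contra hn
  have hi' : i = 1 ∨ i = 4 ∨ i = 6 ∨ i = 8 ∨ i = 11 := by
    simp only [farPos, Finset.mem_insert, Finset.mem_singleton] at hn
    omega
  rcases hi' with rfl | rfl | rfl | rfl | rfl
  · exact key [13, 0, 11, 10, 9, 8, 7] [6, 5, 4, 3, 2, 1, 12] (by decide)
  · exact key [13, 0, 1, 2, 3, 4, 12] [5, 6, 7, 8, 9, 10, 11] (by decide)
  · exact key [13, 0, 1, 2, 3, 4, 5] [11, 10, 9, 8, 7, 6, 12] (by decide)
  · exact key [13, 0, 11, 10, 9, 8, 12] [1, 2, 3, 4, 5, 6, 7] (by decide)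
  · exact key [13, 0, 1, 2, 3, 4, 5] [6, 7, 8, 9, 10, 11, 12] (by decide)

theorem IsTwelveCycle.not_adj_pair (hG : NoTwoPaths G) (hc : IsTwelveCycle G c) (hxy : x ≠ y)
    (hx : ∀ k, x ≠ c k) (hy : ∀ k, y ≠ c k) (h0 : G.Adj y (c 0)) {i j : ℕ}
    (hij : (i, j) = (2, 3) ∨ (i, j) = (2, 10) ∨ (i, j) = (9, 10)) (hi : G.Adj x (c i)) :
    ¬ G.Adj x (c j) := by
  intro hj
  have key : ∀ p q, twoPathsTest [(12, i), (12, j), (13, 0)] p q = true → False := fun p q => by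
    refine hc.not_twoPathsTest hG hxy hx hy ?_
    simp only [Prod.mk.injEq] at hij
    have h1 : i < 12 := by omega
    have h2 : j < 12 := by omega
    simp [cyclePoint, hi, hj, h0, h1, h2]
  simp only [Prod.mk.injEq] at hij
  rcases hij with ⟨rfl, rfl⟩ | ⟨rfl, rfl⟩ | ⟨rfl, rfl⟩
  · exact key [13, 0, 1, 2, 12, 3, 4] [5, 6, 7, 8, 9, 10, 11] (by decide)
  · exact key [13, 0, 1, 2, 12, 10, 11] [3, 4, 5, 6, 7, 8, 9] (by decide)
  · exact key [13, 0, 1, 2, 3, 4, 5] [6, 7, 8, 9, 12, 10, 11] (by decide)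

/-- The path that starts in `13`, continues to `0`, and from there traverses the cycle formed
by `12` and the twelve-cycle with the chord joining the successors (`s = 1`) or the
predecessors (`s = 11`) of the neighbours `i` and `j` of `12`. -/
def chordPath (s i j : ℕ) : List ℕ :=
  let k := (List.range 12).findIdx fun k => (i + (12 - s) * k) % 12 == (j + s) % 12
  let l := 12 :: ((List.range (k + 1)).map (fun t => (i + (12 - s) * t) % 12) ++
    (List.range (11 - k)).map fun t => (i + s * (t + 1)) % 12)
  13 :: l.rotate (l.idxOf 0)

theorem chordPath_test : ∀ s ∈ [1, 11], ∀ i ∈ List.range 12, ∀ j ∈ List.range 12, i ≠ j →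
    twoPathsTest [(12, i), (12, j), ((i + s) % 12, (j + s) % 12), (13, 0)]
      ((chordPath s i j).take 7) ((chordPath s i j).drop 7) = true := by
  decide +kernel

theorem IsTwelveCycle.not_adj_shift (hG : NoTwoPaths G) (hc : IsTwelveCycle G c) (hxy : x ≠ y)
    (hx : ∀ k, x ≠ c k) (hy : ∀ k, y ≠ c k) (h0 : G.Adj y (c 0)) {s i j : ℕ} (hs : s ∈ [1, 11])
    (hi : i < 12) (hj : j < 12) (hij : i ≠ j) (hxi : G.Adj x (c i)) (hxj : G.Adj x (c j)) :
    ¬ G.Adj (c (i + s)) (c (j + s)) := by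
  intro h
  rw [← hc.mod, ← hc.mod (j + s)] at h
  refine hc.not_twoPathsTest hG hxy hx hy ?_
    (chordPath_test s hs i (List.mem_range.2 hi) j (List.mem_range.2 hj) hij)
  have h1 : (i + s) % 12 < 12 := Nat.mod_lt _ (by norm_num)
  have h2 : (j + s) % 12 < 12 := Nat.mod_lt _ (by norm_num)
  simp [cyclePoint, hi, hj, hxi, hxj, h0, h1, h2, h]

end

end

section

variable {V : Type*} [DecidableEq V] {G : SimpleGraph V}

/-- The pairs of positions on a twelve-cycle whose vertices are not adjacent when `A` is the set
of neighbours on the cycle of an outside vertex. -/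
def lostPairs (A : Finset ℕ) : Finset (ℕ × ℕ) :=
  (Finset.range 12 ×ˢ Finset.range 12).filter fun e => e.1 ≠ e.2 ∧
    (((e.1 + 11) % 12 ∈ A ∧ (e.2 + 11) % 12 ∈ A) ∨ ((e.1 + 1) % 12 ∈ A ∧ (e.2 + 1) % 12 ∈ A))

theorem farPos_subsets : ∀ A ∈ farPos.powerset, ¬ (2 ∈ A ∧ 3 ∈ A) → ¬ (2 ∈ A ∧ 10 ∈ A) →
    ¬ (9 ∈ A ∧ 10 ∈ A) → A.card ≤ 5 ∧
    (A.card = 5 → ((Finset.range 12).filter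
      fun j => ∀ i ∈ A, (i + 12 - j) % 12 ∈ farPos).card ≤ 3) ∧
    (4 ≤ A.card → 20 ≤ (lostPairs A).card ∨
      (A = {3, 5, 7, 9} ∧ 20 ≤ (lostPairs A ∪ {(0, 4), (4, 0)}).card)) := by
  decide +kernel

/-- The positions of the neighbours of `x` on a twelve-cycle. -/
noncomputable def cyclePos (G : SimpleGraph V) (c : ℕ → V) (x : V) : Finset ℕ :=
  open Classical in (Finset.range 12).filter fun i => G.Adj x (c i)

theorem mem_cyclePos {c : ℕ → V} {x : V} {i : ℕ} :
    i ∈ cyclePos G c x ↔ i < 12 ∧ G.Adj x (c i) := by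
  simp [cyclePos]

theorem IsTwelveCycle.injOn {c : ℕ → V} (hc : IsTwelveCycle G c) :
    Set.InjOn c (Finset.range 12) := by
  intro a ha b hb hab
  rw [hc.eq_iff] at hab
  simp at ha hb
  omega

theorem IsTwelveCycle.card_cyclePos {c : ℕ → V} (hc : IsTwelveCycle G c) (x : V) :
    (cyclePos G c x).card = degIn G ((Finset.range 12).image c) x := by
  classical
  rw [degIn, Finset.filter_image, Finset.card_image_of_injOn
    (hc.injOn.mono (by intro a; simp +contextual))]
  rfl

theorem IsTwelveCycle.image_shift {c : ℕ → V} (hc : IsTwelveCycle G c) (j : ℕ) :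
    (Finset.range 12).image (fun k => c (k + j)) = (Finset.range 12).image c := by
  refine Finset.eq_of_subset_of_card_le ?_ ?_
  · intro v hv
    simp only [Finset.mem_image, Finset.mem_range] at hv ⊢
    obtain ⟨a, -, rfl⟩ := hv
    exact ⟨(a + j) % 12, Nat.mod_lt _ (by norm_num), hc.mod _⟩
  · rw [Finset.card_image_of_injOn hc.injOn, Finset.card_image_of_injOn (hc.shift j).injOn]

theorem IsTwelveCycle.degSum_add_card_le {c : ℕ → V} (hc : IsTwelveCycle G c)
    {R : Finset (ℕ × ℕ)} (hR : R ⊆ Finset.range 12 ×ˢ Finset.range 12)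
    (hne : ∀ e ∈ R, e.1 ≠ e.2) (h : ∀ e ∈ R, ¬ G.Adj (c e.1) (c e.2)) :
    degSum G ((Finset.range 12).image c) + R.card ≤ 132 := by
  classical
  have h1 : degSum G ((Finset.range 12).image c) =
      ((Finset.range 12 ×ˢ Finset.range 12).filter fun e => G.Adj (c e.1) (c e.2)).card := by
    rw [degSum, Finset.sum_image hc.injOn]
    simp only [← hc.card_cyclePos, cyclePos]
    rw [Finset.card_filter, Finset.sum_product]
    simp only [Finset.card_filter]
  rw [h1, ← Finset.card_union_of_disjoint]
  · refine (Finset.card_le_card (t := (Finset.range 12).offDiag) ?_).trans (by simp)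
    intro e he
    rw [Finset.mem_union, Finset.mem_filter] at he
    rw [Finset.mem_offDiag]
    rcases he with ⟨he, ha⟩ | he
    · rw [Finset.mem_product] at he
      exact ⟨he.1, he.2, fun hh => ha.ne (by rw [hh])⟩
    · have := hR he
      rw [Finset.mem_product] at this
      exact ⟨this.1, this.2, hne e he⟩
  · rw [Finset.disjoint_left]
    intro e he heR
    exact h e heR (Finset.mem_filter.1 he).2

section

variable {c : ℕ → V} {x y : V}

theorem IsTwelveCycle.cyclePos_props (hG : NoTwoPaths G) (hc : IsTwelveCycle G c) (hxy : x ≠ y)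
    (hx : ∀ k, x ≠ c k) (hy : ∀ k, y ≠ c k) (h0 : G.Adj y (c 0)) :
    (cyclePos G c x).card ≤ 5 ∧ ((cyclePos G c x).card = 5 → (cyclePos G c y).card ≤ 3) ∧
      (4 ≤ (cyclePos G c x).card → degSum G ((Finset.range 12).image c) ≤ 112) := by
  have hsub : cyclePos G c x ∈ farPos.powerset := by
    rw [Finset.mem_powerset]
    intro i hi
    obtain ⟨hi, hxi⟩ := mem_cyclePos.1 hi
    exact hc.mem_farPos hG hxy hx hy h0 hi hxi
  have hpair : ∀ i j, ((i, j) = (2, 3) ∨ (i, j) = (2, 10) ∨ (i, j) = (9, 10)) →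
      ¬ (i ∈ cyclePos G c x ∧ j ∈ cyclePos G c x) := fun i j hij h =>
    hc.not_adj_pair hG hxy hx hy h0 hij (mem_cyclePos.1 h.1).2 (mem_cyclePos.1 h.2).2
  obtain ⟨h1, h2, h3⟩ := farPos_subsets _ hsub (hpair 2 3 (by simp)) (hpair 2 10 (by simp))
    (hpair 9 10 (by simp))
  have hlost : ∀ e ∈ lostPairs (cyclePos G c x), ¬ G.Adj (c e.1) (c e.2) := by
    intro e he ha
    simp only [lostPairs, Finset.mem_filter, Finset.mem_product, Finset.mem_range,
      mem_cyclePos] at he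
    obtain ⟨⟨e1, e2⟩, hne, ⟨⟨l1, a1⟩, ⟨l2, a2⟩⟩ | ⟨⟨l1, a1⟩, ⟨l2, a2⟩⟩⟩ := he
    · refine hc.not_adj_shift hG hxy hx hy h0 (s := 1) (by simp) l1 l2 (by omega) a1 a2 ?_
      rwa [(hc.eq_iff ((e.1 + 11) % 12 + 1) e.1).2 (by omega),
        (hc.eq_iff ((e.2 + 11) % 12 + 1) e.2).2 (by omega)]
    · refine hc.not_adj_shift hG hxy hx hy h0 (s := 11) (by simp) l1 l2 (by omega) a1 a2 ?_
      rwa [(hc.eq_iff ((e.1 + 1) % 12 + 11) e.1).2 (by omega),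
        (hc.eq_iff ((e.2 + 1) % 12 + 11) e.2).2 (by omega)]
  have hlsub : lostPairs (cyclePos G c x) ⊆ Finset.range 12 ×ˢ Finset.range 12 :=
    Finset.filter_subset _ _
  have hlne : ∀ e ∈ lostPairs (cyclePos G c x), e.1 ≠ e.2 := fun e he =>
    (Finset.mem_filter.1 he).2.1
  refine ⟨h1, fun h5 => (Finset.card_le_card ?_).trans (h2 h5), fun h4 => ?_⟩
  · intro j hj
    obtain ⟨hj, hyj⟩ := mem_cyclePos.1 hj
    refine Finset.mem_filter.2 ⟨Finset.mem_range.2 hj, fun i hi => ?_⟩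
    obtain ⟨hi, hxi⟩ := mem_cyclePos.1 hi
    refine (hc.shift j).mem_farPos hG hxy (fun k => hx _) (fun k => hy _) ?_
      (Nat.mod_lt _ (by norm_num)) ?_
    · simpa using hyj
    · rwa [(hc.eq_iff _ i).2 (by omega)]
  · rcases h3 h4 with h | ⟨hA, h⟩
    · have := hc.degSum_add_card_le hlsub hlne hlost
      omega
    · have hadj : ∀ i ∈ ({3, 5, 7, 9} : Finset ℕ), G.Adj x (c i) := fun i hi =>
        (mem_cyclePos.1 (hA ▸ hi)).2
      have h04 : ¬ G.Adj (c 0) (c 4) := fun h04 =>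
        hc.not_twoPathsTest hG hxy hx hy (ex := [(0, 4), (12, 3), (12, 9), (13, 0)])
          (by simp [cyclePoint, h0, h04, hadj 3, hadj 9])
          (p := [8, 7, 6, 5, 4, 0, 13]) (q := [1, 2, 3, 12, 9, 10, 11]) (by decide)
      have := hc.degSum_add_card_le (R := lostPairs (cyclePos G c x) ∪ {(0, 4), (4, 0)})
        (Finset.union_subset hlsub (by decide)) ?_ ?_
      · omega
      · intro e he
        simp only [Finset.mem_union, Finset.mem_insert, Finset.mem_singleton] at he
        rcases he with he | rfl | rfl
        · exact hlne e he
        · simp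
        · simp
      · intro e he
        simp only [Finset.mem_union, Finset.mem_insert, Finset.mem_singleton] at he
        rcases he with he | rfl | rfl
        · exact hlost e he
        · exact h04
        · exact fun h => h04 h.symm

end

/-- Every proper nonempty part of `U` is joined by an edge to the rest of `U`. -/
def ConnectedOn (G : SimpleGraph V) (U : Finset V) : Prop :=
  ∀ X ⊆ U, X.Nonempty → X ≠ U → ∃ x ∈ X, ∃ y ∈ U, y ∉ X ∧ G.Adj x y

/-- Vertices outside a cycle on twelve vertices are adjacent only to vertices of the cycle. -/
theorem outside_twelve_cycle (hG : NoTwoPaths G) {T U : Finset V} (hTU : T ⊆ U)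
    (hcon : ConnectedOn G U) (hT : IsHam G T) (hc : T.card = 12) :
    (∀ x ∈ U \ T, ∃ t ∈ T, G.Adj x t) ∧ degSum G (U \ T) = 0 := by
  classical
  have hno : ∀ x ∈ U \ T, (∃ t ∈ T, G.Adj x t) → ∀ y ∈ U \ T, ¬ G.Adj x y := by
    rintro x hx ⟨t, ht, hxt⟩ y hy hxy
    rw [Finset.mem_sdiff] at hx hy
    obtain ⟨m, hm, hmT, hlm⟩ := hT.exists_append ht (y := x) (q := [y])
      ((IsPathList.singleton y).cons hxy (by simpa using hxy.ne))
      (by simp [hx.2, hy.2]) hxt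
    have := hG.length_lt hm
    simp at this hlm
    omega
  have hall : ∀ x ∈ U \ T, ∃ t ∈ T, G.Adj x t := by
    by_contra! hx
    obtain ⟨x, hx, hxT⟩ := hx
    let X := U.filter fun w => w ∈ T ∨ ∃ t ∈ T, G.Adj w t
    have hne : X.Nonempty := by
      obtain ⟨t, ht⟩ : T.Nonempty := Finset.card_pos.1 (by omega)
      exact ⟨t, Finset.mem_filter.2 ⟨hTU ht, Or.inl ht⟩⟩
    have hneU : X ≠ U := by
      intro h
      have : x ∈ X := by rw [h]; exact (Finset.mem_sdiff.1 hx).1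
      rcases (Finset.mem_filter.1 this).2 with h | ⟨t, ht, h⟩
      · exact (Finset.mem_sdiff.1 hx).2 h
      · exact hxT t ht h
    obtain ⟨a, ha, b, hb, hbX, hab⟩ := hcon X (Finset.filter_subset _ _) hne hneU
    simp only [X, Finset.mem_filter, hb, true_and, not_or, not_exists, not_and] at ha hbX
    by_cases haT : a ∈ T
    · exact hbX.2 a haT hab.symm
    · exact hno a (Finset.mem_sdiff.2 ⟨ha.1, haT⟩) (ha.2.resolve_left haT) b
        (Finset.mem_sdiff.2 ⟨hb, hbX.1⟩) hab
  refine ⟨hall, Finset.sum_eq_zero fun x hx => degIn_eq_zero fun y hy => hno x hx (hall x hx) y hy⟩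

theorem degSum_le_of_twelve_cycle (hG : NoTwoPaths G) {T U : Finset V} (hTU : T ⊆ U)
    (hcon : ConnectedOn G U) (hT : IsHam G T) (hc : T.card = 12) (hU : 14 ≤ U.card) :
    degSum G U ≤ 132 + 6 * (U.card - 12) ∨ degSum G U ≤ 112 + 8 * (U.card - 12) := by
  obtain ⟨hatt, hzero⟩ := outside_twelve_cycle hG hTU hcon hT hc
  have hsum := degSum_union (G := G) (Finset.disjoint_sdiff (s := T) (t := U))
  rw [Finset.union_sdiff_of_subset hTU, hzero] at hsum
  have hcard := Finset.card_sdiff_of_subset hTU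
  have hTd := degSum_le_card (G := G) T
  rw [hc] at hTd
  obtain ⟨c, hcyc, rfl⟩ := hT.exists_isTwelveCycle hc
  have hprops : ∀ x ∈ U \ (Finset.range 12).image c, ∀ y ∈ U \ (Finset.range 12).image c,
      x ≠ y → degIn G ((Finset.range 12).image c) x ≤ 5 ∧
      (degIn G ((Finset.range 12).image c) x = 5 →
        degIn G ((Finset.range 12).image c) y ≤ 3) ∧
      (4 ≤ degIn G ((Finset.range 12).image c) x →
        degSum G ((Finset.range 12).image c) ≤ 112) := by
    intro x hx y hy hxy
    obtain ⟨t, ht, hyt⟩ := hatt y hy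
    obtain ⟨j, -, rfl⟩ := Finset.mem_image.1 ht
    have hout : ∀ z ∈ U \ (Finset.range 12).image c, ∀ k, z ≠ c k := by
      rintro z hz k rfl
      refine (Finset.mem_sdiff.1 hz).2 (Finset.mem_image.2 ⟨k % 12, ?_, hcyc.mod k⟩)
      exact Finset.mem_range.2 (Nat.mod_lt _ (by norm_num))
    have := (hcyc.shift j).cyclePos_props hG hxy (fun k => hout x hx _) (fun k => hout y hy _)
      (by simpa using hyt)
    rwa [(hcyc.shift j).card_cyclePos, (hcyc.shift j).card_cyclePos, hcyc.image_shift] at this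
  have hother : ∀ x ∈ U \ (Finset.range 12).image c,
      ∃ y ∈ U \ (Finset.range 12).image c, y ≠ x :=
    fun x hx => Finset.exists_mem_ne (by omega) x
  set T := (Finset.range 12).image c
  set W := U \ T
  by_cases h3 : ∀ x ∈ W, degIn G T x ≤ 3
  · left
    have := Finset.sum_le_card_nsmul W (fun w => degIn G T w) 3 h3
    rw [smul_eq_mul] at this
    omega
  right
  push Not at h3
  obtain ⟨x, hx, hx4⟩ := h3
  obtain ⟨y, hy, hyx⟩ := hother x hx
  have h112 := (hprops x hx y hy hyx.symm).2.2 hx4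
  by_cases h5 : ∃ z ∈ W, degIn G T z = 5
  · obtain ⟨z, hz, hz5⟩ := h5
    have h1 := Finset.add_sum_erase W (fun w => degIn G T w) hz
    have h2 := Finset.sum_le_card_nsmul (W.erase z) (fun w => degIn G T w) 3 fun w hw =>
      (hprops z hz w (Finset.mem_of_mem_erase hw) (Finset.ne_of_mem_erase hw).symm).2.1 hz5
    rw [Finset.card_erase_of_mem hz, smul_eq_mul] at h2
    omega
  · push Not at h5
    have := Finset.sum_le_card_nsmul W (fun w => degIn G T w) 4 fun w hw => by
      obtain ⟨z, hz, hzw⟩ := hother w hw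
      have h1 := (hprops w hw z hz hzw.symm).1
      have h2 := h5 w hw
      omega
    rw [smul_eq_mul] at this
    omega

end

section

variable {V : Type*} [DecidableEq V] {G : SimpleGraph V}

theorem degSum_le_erase_pair {S : Finset V} {x y : V} (hx : x ∈ S) (hy : y ∈ S) (hxy : x ≠ y) :
    degSum G S ≤ degSum G ((S.erase x).erase y) + 2 * degIn G S x + 2 * degIn G S y := by
  have h1 := degSum_erase (G := G) hx
  have h2 := degSum_erase (G := G) (Finset.mem_erase.2 ⟨hxy.symm, hy⟩)
  have h3 := degIn_mono (G := G) (Finset.erase_subset x S) y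
  omega

theorem subset_erase_of_notMem {H S : Finset V} {x : V} (h : H ⊆ S) (hx : x ∉ H) :
    H ⊆ S.erase x := fun z hz => Finset.mem_erase.2 ⟨by rintro rfl; exact hx hz, h hz⟩

theorem exists_mem_notMem_of_ssubset {R S : Finset V} (h : R ⊂ S) : ∃ x ∈ S, x ∉ R :=
  Finset.not_subset.1 h.2

/-- Two distinct members of `S` outside `R`. -/
theorem exists_pair_notMem {R S : Finset V} (h : R ⊆ S) (hc : R.card + 2 ≤ S.card) :
    ∃ x ∈ S, ∃ y ∈ S, x ≠ y ∧ x ∉ R ∧ y ∉ R := by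
  have h1 := Finset.card_sdiff_of_subset h
  obtain ⟨x, hx, y, hy, hxy⟩ := Finset.one_lt_card.1 (show 1 < (S \ R).card by omega)
  rw [Finset.mem_sdiff] at hx hy
  exact ⟨x, hx.1, y, hy.1, hxy, hx.2, hy.2⟩

variable [Finite V] {U H : Finset V}

theorem IsCore.twelve_cycle_of_card_eight (h : IsCore G U H) (hH : H.card = 8)
    (hU : 12 ≤ U.card) (hD : 10 * U.card ≤ degSum G U + 27) :
    ∃ T ⊆ U, T.card = 12 ∧ IsHam G T := by
  obtain ⟨S, hHS, hSU, hS, hDS⟩ := h.exists_card (m := 12) (by omega) hU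
  have hDH := degSum_le_card (G := G) H
  rw [hH] at hDH
  have hbound : ∀ R, H ⊆ R → R ⊆ S → degSum G R + 24 ≤ 10 * R.card := fun R h1 h2 => by
    have := h.degSum_le h1 (h2.trans hSU)
    have := Finset.card_le_card h1
    omega
  refine ⟨S, hSU, hS, isHam_of_core (by omega) hHS (fun v hv => ?_) fun R hHR hRS => ?_⟩
  · have := h.six_le v hv; omega
  have hRc := Finset.card_le_card hHR
  have hRS' := Finset.card_lt_card hRS
  have hfour : ∀ x ∈ S, x ∉ H → 4 ≤ degIn G S x := fun x hx hxH => by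
    have h1 := hbound _ (subset_erase_of_notMem hHS hxH) (Finset.erase_subset x S)
    have h2 := degSum_erase (G := G) hx
    rw [Finset.card_erase_of_mem hx] at h1
    omega
  rcases Nat.lt_or_ge R.card 9 with h9 | h9
  · obtain ⟨x, hx, y, hy, hxy, hxR, hyR⟩ := exists_pair_notMem hRS.1 (by omega)
    have hpair := degSum_le_erase_pair (G := G) hx hy hxy
    have h1 := hbound ((S.erase x).erase y) (subset_erase_of_notMem
      (subset_erase_of_notMem hHS fun h => hxR (hHR h)) fun h => hyR (hHR h))
      ((Finset.erase_subset _ _).trans (Finset.erase_subset _ _))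
    rw [Finset.card_erase_of_mem (Finset.mem_erase.2 ⟨hxy.symm, hy⟩),
      Finset.card_erase_of_mem hx] at h1
    rcases Nat.lt_or_ge (degIn G S x) 5 with h5 | h5
    · exact ⟨y, hy, hyR, by omega⟩
    · exact ⟨x, hx, hxR, by omega⟩
  · obtain ⟨x, hx, hxR⟩ := exists_mem_notMem_of_ssubset hRS
    have := hfour x hx fun h => hxR (hHR h)
    exact ⟨x, hx, hxR, by omega⟩

theorem IsCore.twelve_cycle_of_card_nine (h : IsCore G U H) (hH : H.card = 9)
    (hU : 13 ≤ U.card) (hD : 10 * U.card ≤ degSum G U + 27) :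
    ∃ T ⊆ U, T.card = 12 ∧ IsHam G T := by
  obtain ⟨S, hHS, hSU, hS, hDS⟩ := h.exists_card (m := 13) (by omega) hU
  have hDH := degSum_le_card (G := G) H
  rw [hH] at hDH
  have hbound : ∀ R, H ⊆ R → R ⊆ S → degSum G R + 18 ≤ 10 * R.card := fun R h1 h2 => by
    have := h.degSum_le h1 (h2.trans hSU)
    have := Finset.card_le_card h1
    omega
  obtain ⟨w, hw, hmin⟩ := Finset.exists_min_image (S \ H) (fun x => degIn G S x) (by
    rw [← Finset.card_pos, Finset.card_sdiff_of_subset hHS]; omega)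
  rw [Finset.mem_sdiff] at hw
  have hT : (S.erase w).card = 12 := by rw [Finset.card_erase_of_mem hw.1]; omega
  have hHT := subset_erase_of_notMem hHS hw.2
  have hDw := degSum_erase (G := G) hw.1
  refine ⟨S.erase w, (Finset.erase_subset w S).trans hSU, hT,
    isHam_of_core (by omega) hHT (fun v hv => ?_) fun R hHR hRS => ?_⟩
  · have := h.six_le v hv; omega
  have hRc := Finset.card_le_card hHR
  have hRS' := Finset.card_lt_card hRS
  rcases Nat.lt_or_ge (degIn G S w) 5 with h5 | h5
  · have htwo : ∀ x ∈ S.erase w, x ∉ H → 2 ≤ degIn G (S.erase w) x := fun x hx hxH => by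
      have h1 := hbound _ (subset_erase_of_notMem hHT hxH)
        ((Finset.erase_subset _ _).trans (Finset.erase_subset _ _))
      have h2 := degSum_erase (G := G) hx
      rw [Finset.card_erase_of_mem hx] at h1
      omega
    rcases Nat.lt_or_ge R.card 11 with h9 | h9
    · obtain ⟨x, hx, y, hy, hxy, hxR, hyR⟩ := exists_pair_notMem hRS.1 (by omega)
      have hpair := degSum_le_erase_pair (G := G) hx hy hxy
      have h1 := hbound (((S.erase w).erase x).erase y) (subset_erase_of_notMem
        (subset_erase_of_notMem hHT fun h => hxR (hHR h)) fun h => hyR (hHR h))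
        ((Finset.erase_subset _ _).trans ((Finset.erase_subset _ _).trans
          (Finset.erase_subset _ _)))
      rw [Finset.card_erase_of_mem (Finset.mem_erase.2 ⟨hxy.symm, hy⟩),
        Finset.card_erase_of_mem hx] at h1
      rcases Nat.lt_or_ge (degIn G (S.erase w) x) 4 with h5 | h5
      · exact ⟨y, hy, hyR, by omega⟩
      · exact ⟨x, hx, hxR, by omega⟩
    · obtain ⟨x, hx, hxR⟩ := exists_mem_notMem_of_ssubset hRS
      have := htwo x hx fun h => hxR (hHR h)
      exact ⟨x, hx, hxR, by omega⟩
  · obtain ⟨x, hx, hxR⟩ := exists_mem_notMem_of_ssubset hRS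
    have h1 := hmin x (Finset.mem_sdiff.2
      ⟨Finset.mem_of_mem_erase hx, fun h => hxR (hHR h)⟩)
    classical
    have h2 := degIn_insert (G := G) (Finset.notMem_erase w S) x
    rw [Finset.insert_erase hw.1] at h2
    refine ⟨x, hx, hxR, ?_⟩
    split_ifs at h2 <;> omega

/-- Counting four vertices with `aₖ` neighbours in a core and pairwise adjacency indicators. -/
theorem four_vertex_count (a₁ a₂ a₃ a₄ i₁ i₂ i₃ i₄ i₅ i₆ : ℕ) (b1 : i₁ ≤ 1) (b2 : i₂ ≤ 1)
    (b3 : i₃ ≤ 1) (b4 : i₄ ≤ 1) (b5 : i₅ ≤ 1) (b6 : i₆ ≤ 1) (g1 : a₁ ≤ 5) (g2 : a₂ ≤ 5)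
    (g3 : a₃ ≤ 5) (g4 : a₄ ≤ 5)
    (e1 : 3 ≤ a₁ + i₁ → a₂ + i₁ ≤ 1) (e2 : 3 ≤ a₁ + i₂ → a₃ + i₂ ≤ 1)
    (e3 : 3 ≤ a₁ + i₃ → a₄ + i₃ ≤ 1) (e4 : 3 ≤ a₂ + i₄ → a₃ + i₄ ≤ 1)
    (e5 : 3 ≤ a₂ + i₅ → a₄ + i₅ ≤ 1) (e6 : 3 ≤ a₃ + i₆ → a₄ + i₆ ≤ 1)
    (f1 : 3 ≤ a₂ + i₁ → a₁ + i₁ ≤ 1) (f2 : 3 ≤ a₃ + i₂ → a₁ + i₂ ≤ 1)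
    (f3 : 3 ≤ a₄ + i₃ → a₁ + i₃ ≤ 1) (f4 : 3 ≤ a₃ + i₄ → a₂ + i₄ ≤ 1)
    (f5 : 3 ≤ a₄ + i₅ → a₂ + i₅ ≤ 1) (f6 : 3 ≤ a₄ + i₆ → a₃ + i₆ ≤ 1) :
    i₁ + i₂ + i₃ + i₄ + i₅ + i₆ + a₁ + a₂ + a₃ + a₄ ≤ 11 := by
  have hlin : ∀ a b i : ℕ, a ≤ 2 → b ≤ 2 → i ≤ 1 → (3 ≤ a + i → b + i ≤ 1) →
      (3 ≤ b + i → a + i ≤ 1) → 3 * i + a + b ≤ 5 := by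
    clear * -
    intro a b i; omega
  have hbig : ∀ a b c d i j k l m n : ℕ, 3 ≤ a → a ≤ 5 → l ≤ 1 → m ≤ 1 → n ≤ 1 →
      (3 ≤ a + i → b + i ≤ 1) → (3 ≤ a + j → c + j ≤ 1) → (3 ≤ a + k → d + k ≤ 1) →
      i + j + k + l + m + n + a + b + c + d ≤ 11 := by
    clear * -
    intro a b c d i j k l m n h h5 hl hm hn h1 h2 h3
    have := h1 (by omega)
    have := h2 (by omega)
    have := h3 (by omega)
    clear h1 h2 h3
    omega
  by_cases c1 : 3 ≤ a₁
  · have := hbig a₁ a₂ a₃ a₄ i₁ i₂ i₃ i₄ i₅ i₆ c1 g1 b4 b5 b6 e1 e2 e3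
    clear * - this; omega
  by_cases c2 : 3 ≤ a₂
  · have := hbig a₂ a₁ a₃ a₄ i₁ i₄ i₅ i₂ i₃ i₆ c2 g2 b2 b3 b6 f1 e4 e5
    clear * - this; omega
  by_cases c3 : 3 ≤ a₃
  · have := hbig a₃ a₁ a₂ a₄ i₂ i₄ i₆ i₁ i₃ i₅ c3 g3 b1 b3 b5 f2 f4 e6
    clear * - this; omega
  by_cases c4 : 3 ≤ a₄
  · have := hbig a₄ a₁ a₂ a₃ i₃ i₅ i₆ i₁ i₂ i₄ c4 g4 b1 b2 b4 f3 f5 f6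
    clear * - this; omega
  have c1' := Nat.le_of_lt_succ (not_le.1 c1)
  have c2' := Nat.le_of_lt_succ (not_le.1 c2)
  have c3' := Nat.le_of_lt_succ (not_le.1 c3)
  have c4' := Nat.le_of_lt_succ (not_le.1 c4)
  have k1 := hlin a₁ a₂ i₁ c1' c2' b1 e1 f1
  have k2 := hlin a₁ a₃ i₂ c1' c3' b2 e2 f2
  have k3 := hlin a₁ a₄ i₃ c1' c4' b3 e3 f3
  have k4 := hlin a₂ a₃ i₄ c2' c3' b4 e4 f4
  have k5 := hlin a₂ a₄ i₅ c2' c4' b5 e5 f5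
  have k6 := hlin a₃ a₄ i₆ c3' c4' b6 e6 f6
  clear * - k1 k2 k3 k4 k5 k6
  linarith

open Classical in
theorem IsCore.twelve_cycle_of_card_ten (h : IsCore G U H) (hH : H.card = 10)
    (hU : 14 ≤ U.card) (hD : 10 * U.card ≤ degSum G U + 27) :
    ∃ T ⊆ U, T.card = 12 ∧ IsHam G T := by
  obtain ⟨S, hHS, hSU, hS, hDS⟩ := h.exists_card (m := 14) (by omega) hU
  have hDH := degSum_le_card (G := G) H
  rw [hH] at hDH
  by_contra hno
  have hfive : ∀ x ∈ S \ H, degIn G H x ≤ 5 := by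
    intro x hx
    rw [Finset.mem_sdiff] at hx
    obtain ⟨v, hv, hvH, hv5⟩ := h.exists_le (insert x H) (Finset.ssubset_insert hx.2)
      (Finset.insert_subset (hSU hx.1) h.subset)
    obtain rfl : v = x := by
      rcases Finset.mem_insert.1 hv with h | h
      · exact h
      · exact absurd h hvH
    rwa [degIn_insert_self hx.2] at hv5
  have hpair : ∀ x ∈ S \ H, ∀ y ∈ S \ H, x ≠ y → 
      3 ≤ degIn G H x + (if G.Adj x y then 1 else 0) →
      degIn G H y + (if G.Adj x y then 1 else 0) ≤ 1 := by
    intro x hx y hy hxy h3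
    by_contra! h2
    rw [Finset.mem_sdiff] at hx hy
    have hyx : y ∉ insert x H := by simp [hxy.symm, hy.2]
    have hxy' : x ∉ insert y H := by simp [hxy, hx.2]
    have hc : (insert y (insert x H)).card = 12 := by
      rw [Finset.card_insert_of_notMem hyx, Finset.card_insert_of_notMem hx.2, hH]
    have hdx : 3 ≤ degIn G (insert y (insert x H)) x := by
      rw [Finset.insert_comm, degIn_insert_self hxy', degIn_insert hy.2]
      exact h3
    have hdy : 2 ≤ degIn G (insert y (insert x H)) y := by
      rw [degIn_insert_self hyx, degIn_insert hx.2]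
      rw [G.adj_comm y x]
      exact h2
    refine hno ⟨insert y (insert x H), Finset.insert_subset (hSU hy.1)
      (Finset.insert_subset (hSU hx.1) h.subset), hc, isHam_of_core (by omega)
      ((Finset.subset_insert _ _).trans (Finset.subset_insert _ _)) (fun v hv => ?_)
      fun R hHR hRS => ?_⟩
    · have := h.six_le v hv; omega
    have hRc := Finset.card_le_card hHR
    by_cases hxR : x ∈ R
    · refine ⟨y, by simp, fun hyR => hRS.2 (Finset.insert_subset hyR
        (Finset.insert_subset hxR hHR)), ?_⟩
      have := Finset.card_le_card (Finset.insert_subset hxR hHR)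
      rw [Finset.card_insert_of_notMem hx.2] at this
      omega
    · exact ⟨x, by simp, hxR, by omega⟩
  have hW : (S \ H).card = 4 := by rw [Finset.card_sdiff_of_subset hHS]; omega
  have hsum := degSum_union (G := G) (Finset.disjoint_sdiff (s := H) (t := S))
  rw [Finset.union_sdiff_of_subset hHS] at hsum
  generalize S \ H = W at *
  obtain ⟨p, W', hp, rfl, hW'⟩ := Finset.card_eq_succ.1 hW
  obtain ⟨q, r, s, hqr, hqs, hrs, rfl⟩ := Finset.card_eq_three.1 hW'
  simp only [Finset.mem_insert, Finset.mem_singleton, not_or] at hp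
  obtain ⟨hpq, hpr, hps⟩ := hp
  have e1 := hpair p (by simp) q (by simp) hpq
  have e2 := hpair p (by simp) r (by simp) hpr
  have e3 := hpair p (by simp) s (by simp) hps
  have e4 := hpair q (by simp) r (by simp) hqr
  have e5 := hpair q (by simp) s (by simp) hqs
  have e6 := hpair r (by simp) s (by simp) hrs
  have f1 := hpair q (by simp) p (by simp) (Ne.symm hpq)
  have f2 := hpair r (by simp) p (by simp) (Ne.symm hpr)
  have f3 := hpair s (by simp) p (by simp) (Ne.symm hps)
  have f4 := hpair r (by simp) q (by simp) hqr.symm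
  have f5 := hpair s (by simp) q (by simp) hqs.symm
  have f6 := hpair s (by simp) r (by simp) hrs.symm
  rw [G.adj_comm] at f1 f2 f3 f4 f5 f6
  have g1 := hfive p (by simp)
  have g2 := hfive q (by simp)
  have g3 := hfive r (by simp)
  have g4 := hfive s (by simp)
  have hDW : degSum G {p, q, r, s} = 2 * ((if G.Adj p q then 1 else 0) +
      (if G.Adj p r then 1 else 0) + (if G.Adj p s then 1 else 0) +
      (if G.Adj q r then 1 else 0) + (if G.Adj q s then 1 else 0) +
      (if G.Adj r s then 1 else 0)) := by
    have m1 : p ∉ ({q, r, s} : Finset V) := by simp [hpq, hpr, hps]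
    have m2 : q ∉ ({r, s} : Finset V) := by simp [hqr, hqs]
    have m3 : r ∉ ({s} : Finset V) := by simp [hrs]
    have hs : degSum G {s} = 0 := by simpa using degSum_le_card (G := G) {s}
    have hd : ∀ x, degIn G {s} x = if G.Adj x s then 1 else 0 := fun x => by
      rw [degIn_eq_sum, Finset.sum_singleton]
    rw [degSum_insert m1, degSum_insert m2, degSum_insert m3, hs, degIn_insert m2,
      degIn_insert m3, degIn_insert m3, hd, hd, hd]
    ring
  rw [hDW, Finset.sum_insert (by simp [hpq, hpr, hps]), Finset.sum_insert (by simp [hqr, hqs]),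
      Finset.sum_insert (by simp [hrs]), Finset.sum_singleton] at hsum
  have b : ∀ a b, (if G.Adj a b then 1 else 0) ≤ 1 := fun a b => by split_ifs <;> simp
  have b1 := b p q
  have b2 := b p r
  have b3 := b p s
  have b4 := b q r
  have b5 := b q s
  have b6 := b r s
  have := four_vertex_count (degIn G H p) (degIn G H q) (degIn G H r) (degIn G H s) _ _ _ _ _ _
    b1 b2 b3 b4 b5 b6 g1 g2 g3 g4 e1 e2 e3 e4 e5 e6 f1 f2 f3 f4 f5 f6
  clear e1 e2 e3 e4 e5 e6 f1 f2 f3 f4 f5 f6 b1 b2 b3 b4 b5 b6 g1 g2 g3 g4 hpair hfive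
  omega

end

section

variable {V : Type*} [DecidableEq V] {G : SimpleGraph V}

theorem degSum_le_of_no_two_step {W : Finset V} (hW : W.card = 5) {x : V} (hx : x ∈ W)
    (h : ∀ y ∈ W, ∀ z ∈ W, G.Adj x y → G.Adj y z → z = x) : degSum G W ≤ 12 := by
  classical
  have h1 := degSum_erase (G := G) hx
  set Y := (W.erase x).filter (G.Adj x) with hY
  have hYW : Y ⊆ W.erase x := Finset.filter_subset _ _
  have hYc : degIn G W x ≤ Y.card := degIn_le_of_imp fun w hw ha =>
    Finset.mem_filter.2 ⟨Finset.mem_erase.2 ⟨ha.ne', hw⟩, ha⟩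
  have hiso : ∀ y ∈ Y, ∀ z ∈ W.erase x, ¬ G.Adj y z := fun y hy z hz ha => by
    rw [hY, Finset.mem_filter, Finset.mem_erase] at hy
    rw [Finset.mem_erase] at hz
    exact hz.1 (h y hy.1.2 z hz.2 hy.2 ha)
  have h2 := degSum_sdiff_of_closed (G := G) hYW fun y hy z hz _ => hiso y hy z hz
  have h3 : degSum G Y = 0 := Finset.sum_eq_zero fun y hy =>
    degIn_eq_zero fun z hz => hiso y hy z (hYW hz)
  have h4 := degSum_le_card (G := G) (W.erase x \ Y)
  have h5 := Finset.card_le_card hYW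
  rw [Finset.card_sdiff_of_subset hYW] at h4
  rw [Finset.card_erase_of_mem hx, hW] at h4 h5
  generalize Y.card = k at *
  interval_cases k <;> omega

variable [Finite V] {U H : Finset V}

theorem IsCore.isHam (h : IsCore G U H) (h3 : 3 ≤ H.card) (h12 : H.card ≤ 12) : IsHam G H := by
  refine isHam_of_core h3 subset_rfl (fun v hv => ?_) fun S h1 h2 => absurd h1 h2.2
  have := h.six_le v hv
  omega

theorem IsCore.twelve_cycle_of_card_eleven (hG : NoTwoPaths G) (h : IsCore G U H)
    (hH : H.card = 11) (hU : 16 ≤ U.card) (hD : 10 * U.card ≤ degSum G U + 27) :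
    ∃ T ⊆ U, T.card = 12 ∧ IsHam G T := by
  obtain ⟨S, hHS, hSU, hS, hDS⟩ := h.exists_card (m := 16) (by omega) hU
  have hDH := degSum_le_card (G := G) H
  rw [hH] at hDH
  by_contra hno
  have hone : ∀ x ∈ S \ H, degIn G H x ≤ 1 := by
    intro x hx
    rw [Finset.mem_sdiff] at hx
    by_contra! h2
    have hc := Finset.card_insert_of_notMem hx.2
    refine hno ⟨insert x H, Finset.insert_subset (hSU hx.1) h.subset, by omega,
      isHam_of_core (by omega) (Finset.subset_insert _ _) (fun v hv => ?_) fun R hHR hRS =>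
        ⟨x, by simp, fun hxR => hRS.2 (Finset.insert_subset hxR hHR), ?_⟩⟩
    · have := h.six_le v hv; omega
    · have := Finset.card_le_card hHR
      rw [degIn_insert_self hx.2]
      omega
  have hham := h.isHam (by omega) (by omega)
  have hWc : (S \ H).card = 5 := by rw [Finset.card_sdiff_of_subset hHS]; omega
  have hsum := degSum_union (G := G) (Finset.disjoint_sdiff (s := H) (t := S))
  rw [Finset.union_sdiff_of_subset hHS] at hsum
  have hsum5 : ∑ x ∈ S \ H, degIn G H x ≤ _ := Finset.sum_le_card_nsmul _ _ _ hone
  have hDW := degSum_le_card (G := G) (S \ H)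
  rw [hWc] at hsum5 hDW
  simp only [smul_eq_mul] at hsum5
  by_cases hatt : ∃ x ∈ S \ H, 0 < degIn G H x
  · obtain ⟨x, hx, hxa⟩ := hatt
    obtain ⟨t, ht, hxt⟩ := degIn_pos.1 hxa
    have := degSum_le_of_no_two_step (G := G) hWc hx fun y hy z hz hxy hyz => by
      by_contra hzx
      rw [Finset.mem_sdiff] at hx hy hz
      obtain ⟨m, hm, -, hlen⟩ := hham.exists_append (q := [y, z]) ht
        (⟨by simp [hxy, hyz], by simp [hxy.ne, hyz.ne, Ne.symm hzx]⟩ : IsPathList G [x, y, z])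
        (by simp [hx.2, hy.2, hz.2]) hxt
      have := hG.length_lt hm
      rw [List.length_append, hlen] at this
      simp at this
      omega
    omega
  · push Not at hatt
    rw [Finset.sum_eq_zero fun x hx => Nat.le_zero.1 (hatt x hx)] at hsum
    omega

end

section

variable {V : Type*} [DecidableEq V] {G : SimpleGraph V}

/-- A path hanging off a path `l` at position `i` can be continued along the rest of `l`. -/
theorem IsPathList.append_drop {l q : List V} {x : V} {i : ℕ} (hl : IsPathList G l)
    (hq : IsPathList G (x :: q)) (hd : (x :: q).Disjoint l) (hi : i < l.length)
    (hx : G.Adj x l[i]) : IsPathList G ((x :: q).reverse ++ l.drop i) := by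
  refine hq.reverse.append (hl.drop i) ?_ ?_
  · intro a ha hb
    exact hd (List.mem_reverse.1 ha) (List.mem_of_mem_drop hb)
  · intro a ha b hb
    rw [List.drop_eq_getElem_cons hi] at hb
    simp only [List.reverse_cons, List.getLast?_concat, Option.mem_def, Option.some.injEq,
      List.head?_cons] at ha hb
    subst ha hb
    exact hx

theorem NoTwoPaths.attach_le (hG : NoTwoPaths G) {l q : List V} {x : V} {i : ℕ}
    (hl : IsPathList G l) (h13 : l.length = 13) (hq : IsPathList G (x :: q))
    (hd : (x :: q).Disjoint l) (hi : i < l.length) (hx : G.Adj x l[i]) :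
    q.length + 1 ≤ i ∧ (7 ≤ i → q.length + 8 ≤ i) := by
  have hp := hl.append_drop hq hd hi hx
  constructor
  · have := hG.length_lt hp
    simp at this
    omega
  · intro h7
    by_contra! hlt
    refine hG _ _ hp (hl.take i) ?_ (by simp; omega) (by simp; omega)
    intro a ha hb
    rcases List.mem_append.1 ha with h | h
    · exact hd (List.mem_reverse.1 h) (List.mem_of_mem_take hb)
    · have := hl.2
      rw [← List.take_append_drop i l] at this
      exact (List.nodup_append'.1 this).2.2 hb h

/-- Where a path with `q.length + 1` vertices can hang off a path with thirteen vertices. -/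
theorem NoTwoPaths.attach (hG : NoTwoPaths G) {l q : List V} {x : V} {i : ℕ}
    (hl : IsPathList G l) (h13 : l.length = 13) (hq : IsPathList G (x :: q))
    (hd : (x :: q).Disjoint l) (hi : i ∈ nbrPos G l x) :
    q.length + 1 ≤ i ∧ i + q.length + 1 ≤ 12 ∧ (7 ≤ i → q.length + 8 ≤ i) ∧
      (i ≤ 5 → i + q.length + 1 ≤ 5) := by
  obtain ⟨hi, hx⟩ := mem_nbrPos.1 hi
  have h1 := hG.attach_le hl h13 hq hd hi hx
  have h2 := hG.attach_le (i := 12 - i) hl.reverse (by simpa using h13) hq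
    (fun a ha hb => hd ha (List.mem_reverse.1 hb)) (by simp; omega) (by
      rw [List.getElem_reverse]
      convert hx using 2
      omega)
  omega

theorem NoTwoPaths.not_attach_succ (hG : NoTwoPaths G) {l : List V} {x : V} {i : ℕ}
    (hl : IsPathList G l) (h13 : l.length = 13) (hxl : x ∉ l) (hi : i ∈ nbrPos G l x) :
    i + 1 ∉ nbrPos G l x := by
  intro hi'
  obtain ⟨hi, hx⟩ := mem_nbrPos.1 hi
  obtain ⟨hi', hx'⟩ := mem_nbrPos.1 hi'
  have hp := (hl.take (i + 1)).append
    (hl.append_drop (IsPathList.singleton x) (by simpa using hxl) hi' hx') (by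
      intro a ha hb
      rcases List.mem_append.1 hb with h | h
      · simp at h
        subst h
        exact hxl (List.mem_of_mem_take ha)
      · have := hl.2
        rw [← List.take_append_drop (i + 1) l] at this
        exact (List.nodup_append'.1 this).2.2 ha h) (by
      intro a ha b hb
      simp [List.getLast?_take, hi] at ha hb
      subst ha hb
      exact hx.symm)
  have := hG.length_lt hp
  simp at this
  omega

/-- Replacing the vertex at position `j + 1` of a path by a common neighbour of the vertices
at positions `j` and `j + 2`. -/
theorem IsPathList.set {l : List V} {x : V} {j : ℕ} (hl : IsPathList G l) (hxl : x ∉ l)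
    (h0 : j ∈ nbrPos G l x) (h2 : j + 2 ∈ nbrPos G l x) :
    IsPathList G (l.take (j + 1) ++ x :: l.drop (j + 2)) := by
  obtain ⟨hi, hx⟩ := mem_nbrPos.1 h0
  obtain ⟨hi', hx'⟩ := mem_nbrPos.1 h2
  refine (hl.take (j + 1)).append
    (hl.append_drop (IsPathList.singleton x) (by simpa using hxl) hi' hx') ?_ ?_
  · intro a ha hb
    rcases List.mem_cons.1 hb with h | h
    · subst h
      exact hxl (List.mem_of_mem_take ha)
    · have := hl.2
      rw [← List.take_append_drop (j + 1) l] at this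
      refine (List.nodup_append'.1 this).2.2 ha ?_
      have e : l.drop (j + 2) = (l.drop (j + 1)).drop 1 := by simp
      rw [e] at h
      exact List.mem_of_mem_drop h
  · intro a ha b hb
    simp [List.getLast?_take, hi] at ha hb
    subst ha hb
    exact hx.symm

theorem card_le_of_attach_one : ∀ A ∈ ({1, 2, 3, 4, 6, 8, 9, 10, 11} : Finset ℕ).powerset,
    (∀ i ∈ A, i + 1 ∉ A) → A.card ≤ 5 ∧ ((∀ i ∈ A, i + 2 ∉ A) → A.card ≤ 4) := by
  decide +kernel

theorem card_le_of_attach_two : ∀ A ∈ ({2, 3, 6, 9, 10} : Finset ℕ).powerset,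
    (∀ i ∈ A, i + 1 ∉ A) → A.card ≤ 3 := by
  decide +kernel

theorem NoTwoPaths.nbrPos_mem_powerset (hG : NoTwoPaths G) {l : List V} {x : V}
    (hl : IsPathList G l) (h13 : l.length = 13) (hxl : x ∉ l) :
    nbrPos G l x ∈ ({1, 2, 3, 4, 6, 8, 9, 10, 11} : Finset ℕ).powerset := by
  rw [Finset.mem_powerset]
  intro i hi
  have := hG.attach hl h13 (IsPathList.singleton x) (by simpa using hxl) hi
  simp at this ⊢
  omega

theorem NoTwoPaths.degIn_le_five (hG : NoTwoPaths G) {l : List V} {x : V}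
    (hl : IsPathList G l) (h13 : l.length = 13) (hxl : x ∉ l) : degIn G l.toFinset x ≤ 5 := by
  rw [← card_nbrPos hl.2]
  exact (card_le_of_attach_one _ (hG.nbrPos_mem_powerset hl h13 hxl)
    fun i hi => hG.not_attach_succ hl h13 hxl hi).1

theorem NoTwoPaths.degIn_le_three (hG : NoTwoPaths G) {l : List V} {x y : V}
    (hl : IsPathList G l) (h13 : l.length = 13) (hxl : x ∉ l) (hyl : y ∉ l) (hxy : G.Adj x y) :
    degIn G l.toFinset x ≤ 3 := by
  rw [← card_nbrPos hl.2]
  refine card_le_of_attach_two _ ?_ fun i hi => hG.not_attach_succ hl h13 hxl hi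
  rw [Finset.mem_powerset]
  intro i hi
  have := hG.attach (q := [y]) hl h13 ⟨by simp [hxy], by simp [hxy.ne]⟩
    (by simp [hxl, hyl]) hi
  simp at this ⊢
  omega

theorem NoTwoPaths.nbrPos_subset (hG : NoTwoPaths G) {l : List V} {x y z : V}
    (hl : IsPathList G l) (h13 : l.length = 13) (hxl : x ∉ l) (hyl : y ∉ l) (hzl : z ∉ l)
    (hxy : G.Adj x y) (hyz : G.Adj y z) (hzx : z ≠ x) : nbrPos G l x ⊆ {6} := by
  intro i hi
  have := hG.attach (q := [y, z]) hl h13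
    ⟨by simp [hxy, hyz], by simp [hxy.ne, hyz.ne, hzx.symm]⟩ (by simp [hxl, hyl, hzl]) hi
  simp at this ⊢
  omega

theorem NoTwoPaths.degIn_le_one (hG : NoTwoPaths G) {l : List V} {x y z : V}
    (hl : IsPathList G l) (h13 : l.length = 13) (hxl : x ∉ l) (hyl : y ∉ l) (hzl : z ∉ l)
    (hxy : G.Adj x y) (hyz : G.Adj y z) (hzx : z ≠ x) : degIn G l.toFinset x ≤ 1 := by
  rw [← card_nbrPos hl.2]
  exact Finset.card_le_card (hG.nbrPos_subset hl h13 hxl hyl hzl hxy hyz hzx)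

/-- If every vertex of a path with thirteen vertices has at least six neighbours on the path, then
every other vertex has at most four. -/
theorem NoTwoPaths.degIn_le_four (hG : NoTwoPaths G) {l : List V} {x : V}
    (hl : IsPathList G l) (h13 : l.length = 13) (hxl : x ∉ l)
    (h6 : ∀ v ∈ l, 6 ≤ degIn G l.toFinset v) : degIn G l.toFinset x ≤ 4 := by
  rw [← card_nbrPos hl.2]
  refine (card_le_of_attach_one _ (hG.nbrPos_mem_powerset hl h13 hxl)
    fun i hi => hG.not_attach_succ hl h13 hxl hi).2 fun j h0 h2 => ?_
  have hp := hl.set hxl h0 h2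
  obtain ⟨hj, -⟩ := mem_nbrPos.1 h2
  have hs : l = l.take (j + 1) ++ l[j + 1] :: l.drop (j + 2) := by
    rw [← List.drop_eq_getElem_cons, List.take_append_drop]
  have hnd := hl.2
  rw [hs] at hnd
  have hmem : l[j + 1] ∉ l.take (j + 1) ++ x :: l.drop (j + 2) := by
    rw [List.nodup_middle, List.nodup_cons, List.mem_append] at hnd
    intro h
    simp only [List.mem_append, List.mem_cons] at h
    rcases h with h | h | h
    · exact hnd.1 (Or.inl h)
    · exact hxl (h ▸ List.getElem_mem _)
    · exact hnd.1 (Or.inr h)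
  have h5 := hG.degIn_le_five hp (by simp; omega) hmem
  have := h6 _ (List.getElem_mem (l := l) (n := j + 1) (by omega))
  have hle : degIn G l.toFinset l[j + 1] ≤
      degIn G (l.take (j + 1) ++ x :: l.drop (j + 2)).toFinset l[j + 1] := by
    refine degIn_le_degIn_of_imp fun w hw ha => ?_
    rw [List.mem_toFinset] at hw ⊢
    rw [hs] at hw
    simp only [List.mem_append, List.mem_cons] at hw ⊢
    rcases hw with h | h | h
    · exact Or.inl h
    · exact absurd h ha.ne'
    · exact Or.inr (Or.inr h)
  omega

end

section

variable {V : Type*} [DecidableEq V] {G : SimpleGraph V} {U H : Finset V}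

theorem IsHam.exists_path {T : Finset V} (h : IsHam G T) :
    ∃ l, IsPathList G l ∧ l.toFinset = T ∧ l.length = T.card := by
  obtain ⟨l, hl, rfl⟩ := h
  exact ⟨l, hl.1, rfl, hl.1.card_toFinset.symm⟩

theorem degIn_sdiff_of_closed {T : Finset V} (h : ∀ x ∈ T, ∀ y ∈ U, y ∉ T → ¬ G.Adj x y)
    {y : V} (hy : y ∈ U) (hyT : y ∉ T) : degIn G U y ≤ degIn G (U \ T) y :=
  degIn_le_degIn_of_imp fun w hw ha =>
    Finset.mem_sdiff.2 ⟨hw, fun hwT => h w hwT y hy hyT ha.symm⟩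

theorem exists_path_of_degIn (hne : H.Nonempty) {d : ℕ} (hdeg : ∀ v ∈ H, d ≤ degIn G H v) :
    ∃ l, IsPathList G l ∧ (∀ x ∈ l, x ∈ H) ∧ d + 1 ≤ l.length := by
  rcases exists_long_path_or_closed_cycle hne hdeg with ⟨l, h1, h2, h3⟩ | ⟨T, h1, h2, h3, -, -⟩
  · exact ⟨l, h1, h2, by omega⟩
  · obtain ⟨l, hl, rfl, hlen⟩ := h2.exists_path
    exact ⟨l, hl, fun x hx => h1 (List.mem_toFinset.2 hx), by omega⟩

theorem NoTwoPaths.exists_path_thirteen (hG : NoTwoPaths G) (h6 : ∀ v ∈ H, 6 ≤ degIn G H v)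
    (hc : 13 ≤ H.card) : ∃ l, IsPathList G l ∧ (∀ x ∈ l, x ∈ H) ∧ l.length = 13 := by
  rcases exists_long_path_or_closed_cycle (Finset.card_pos.1 (by omega)) h6 with
    ⟨l, h1, h2, h3⟩ | ⟨T, hTH, hT, h7, h12, hcl⟩
  · have := hG.length_lt h1
    exact ⟨l, h1, h2, by omega⟩
  · exfalso
    obtain ⟨l, hl, rfl, hlen⟩ := hT.exists_path
    obtain ⟨m, hm, hmH, hm7⟩ := exists_path_of_degIn (G := G) (H := H \ l.toFinset) (d := 6)
      (by rw [← Finset.card_pos, Finset.card_sdiff_of_subset hTH]; omega) (fun v hv => by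
        rw [Finset.mem_sdiff] at hv
        exact (h6 v hv.1).trans (degIn_sdiff_of_closed hcl hv.1 hv.2))
    refine hG l m hl hm (fun a ha hb => ?_) (by omega) hm7
    exact (Finset.mem_sdiff.1 (hmH a hb)).2 (List.mem_toFinset.2 ha)

theorem ConnectedOn.not_isHam (hG : NoTwoPaths G) (hcon : ConnectedOn G U) (hH : H ⊆ U)
    (hc : H.card = 13) (hU : 14 ≤ U.card) : ¬ IsHam G H := by
  intro hham
  obtain ⟨x, hx, y, hy, hyH, ha⟩ := hcon H hH (Finset.card_pos.1 (by omega))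
    (by rintro rfl; omega)
  obtain ⟨m, hm, -, hlen⟩ := hham.exists_append (q := []) hx (IsPathList.singleton y)
    (by simpa using hyH) ha.symm
  have := hG.length_lt hm
  rw [List.length_append, hlen] at this
  simp at this
  omega

/-- The path obtained by reversing the part of `l` that precedes a neighbour of its first vertex. -/
theorem IsPathList.rotate {l : List V} (hl : IsPathList G l) {i : ℕ} (hi : i + 1 < l.length)
    (ha : G.Adj (l[0]'(by omega)) l[i + 1]) :
    IsPathList G ((l.take (i + 1)).reverse ++ l.drop (i + 1)) := by
  refine (hl.take (i + 1)).reverse.append (hl.drop (i + 1)) ?_ ?_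
  · intro a ha hb
    have := hl.2
    rw [← List.take_append_drop (i + 1) l] at this
    exact (List.nodup_append'.1 this).2.2 (List.mem_reverse.1 ha) hb
  · intro a h1 b h2
    rw [List.drop_eq_getElem_cons hi] at h2
    rw [List.getLast?_reverse, List.head?_take] at h1
    simp [List.head?_eq_getElem?, List.getElem?_eq_getElem (show 0 < l.length by omega)] at h1
    simp only [Option.mem_def, Option.some.injEq, List.head?_cons] at h2
    subst h1 h2
    exact ha

theorem IsPathList.degIn_eq_six {l : List V} (hl : IsPathList G l) (h13 : l.length = 13)
    (hno : ¬ IsHam G l.toFinset) (h6 : ∀ v ∈ l, 6 ≤ degIn G l.toFinset v) :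
    degIn G l.toFinset l[0] ≤ 6 ∧ degIn G l.toFinset l[12] ≤ 6 := by
  have h1 := h6 l[0] (List.getElem_mem _)
  have h2 := h6 l[12] (List.getElem_mem _)
  by_contra hlt
  refine hno (hl.isHam (by omega) ?_)
  have e : l[l.length - 1] = l[12] := by congr 1; omega
  rw [e]
  omega

theorem degSum_le_of_path_thirteen {l : List V} (hl : IsPathList G l) (h13 : l.length = 13)
    (hno : ¬ IsHam G l.toFinset) (h6 : ∀ v ∈ l, 6 ≤ degIn G l.toFinset v) :
    degSum G l.toFinset ≤ 114 := by
  classical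
  have hend := hl.degIn_eq_six h13 hno h6
  set B := l.toFinset.filter fun v => degIn G l.toFinset v ≤ 6 with hB
  have hrot : ∀ i, (hi : i + 1 < l.length) → G.Adj l[0] l[i + 1] → l[i] ∈ B := by
    intro i hi ha
    have hr := hl.rotate hi ha
    have he : ((l.take (i + 1)).reverse ++ l.drop (i + 1)).toFinset = l.toFinset := by
      rw [List.toFinset_append, List.toFinset_reverse, ← List.toFinset_append,
        List.take_append_drop]
    have hlen : ((l.take (i + 1)).reverse ++ l.drop (i + 1)).length = 13 := by
      simp; omega
    have := (hr.degIn_eq_six hlen (by rwa [he]) (fun v hv => by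
      rw [he]
      refine h6 v (List.mem_toFinset.1 ?_)
      rw [← he]
      exact List.mem_toFinset.2 hv)).1
    rw [he] at this
    have e0 : ((l.take (i + 1)).reverse ++ l.drop (i + 1))[0] = l[i] := by
      rw [List.getElem_append_left (by simp; omega), List.getElem_reverse]
      simp only [List.getElem_take]
      congr 1
      simp
      omega
    rw [e0] at this
    exact Finset.mem_filter.2 ⟨List.mem_toFinset.2 (List.getElem_mem _), this⟩
  have hcard : 7 ≤ B.card := by
    have h0 := h6 l[0] (List.getElem_mem _)
    rw [← card_nbrPos hl.2] at h0
    have hinj : (insert 12 ((nbrPos G l l[0]).image fun i => i - 1)).card ≤ B.card := by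
      refine Finset.card_le_card_of_injOn (fun i => l.getD i l[0]) ?_ ?_
      · intro i hi
        rw [Finset.mem_coe, Finset.mem_insert, Finset.mem_image] at hi
        rcases hi with rfl | ⟨k, hk, rfl⟩
        · simp only [List.getD_eq_getElem?_getD, h13, Nat.reduceLT, List.getElem?_eq_getElem, 
            Option.getD_some]
          exact Finset.mem_filter.2 ⟨List.mem_toFinset.2 (List.getElem_mem _), hend.2⟩
        · obtain ⟨hk', ha⟩ := mem_nbrPos.1 hk
          obtain _ | k := k
          · exact absurd ha (by simp)
          · have := hrot k hk' ha
            have hk2 : k < l.length := by omega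
            simpa [List.getD_eq_getElem?_getD, List.getElem?_eq_getElem hk2] using this
      · intro i hi j hj hij
        have hlt : ∀ i ∈ insert 12 ((nbrPos G l l[0]).image fun i => i - 1), i < l.length := by
          intro i hi
          rw [Finset.mem_insert, Finset.mem_image] at hi
          rcases hi with rfl | ⟨k, hk, rfl⟩
          · omega
          · obtain ⟨hk', ha⟩ := mem_nbrPos.1 hk
            omega
        have hi' := hlt i (by simpa using hi)
        have hj' := hlt j (by simpa using hj)
        simp only [List.getD_eq_getElem?_getD, List.getElem?_eq_getElem hi',
          List.getElem?_eq_getElem hj', Option.getD_some] at hij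
        exact (hl.2.getElem_inj_iff).1 hij
    have hpos : ∀ i ∈ nbrPos G l l[0], 0 < i ∧ i < 13 := by
      intro i hi
      obtain ⟨hk', ha⟩ := mem_nbrPos.1 hi
      refine ⟨Nat.pos_of_ne_zero ?_, by omega⟩
      rintro rfl
      exact absurd ha (by simp)
    rw [Finset.card_insert_of_notMem, Finset.card_image_of_injOn] at hinj
    · omega
    · intro i hi j hj hij
      have := hpos i hi
      have := hpos j hj
      simp only at hij
      omega
    · intro h
      obtain ⟨k, hk, h⟩ := Finset.mem_image.1 h
      have := hpos k hk
      omega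
  have hBl : B ⊆ l.toFinset := Finset.filter_subset _ _
  have hc := hl.card_toFinset
  have s1 : ∑ v ∈ B, degIn G l.toFinset v ≤ B.card * 6 :=
    (Finset.sum_le_card_nsmul _ _ 6 fun v hv => (Finset.mem_filter.1 hv).2).trans
      (by rw [smul_eq_mul])
  have s2 : ∑ v ∈ l.toFinset \ B, degIn G l.toFinset v ≤ (l.toFinset \ B).card * 12 :=
    (Finset.sum_le_card_nsmul _ _ 12 fun v hv => by
      have := degIn_lt_card (G := G) (Finset.mem_sdiff.1 hv).1
      omega).trans (by simp)
  rw [Finset.card_sdiff_of_subset hBl] at s2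
  have s3 := Finset.sum_sdiff (f := fun v => degIn G l.toFinset v) hBl
  have := Finset.card_le_card hBl
  unfold degSum
  omega

theorem NoTwoPaths.degSum_add_le (hG : NoTwoPaths G) {l : List V}
    (hl : IsPathList G l) (h13 : l.length = 13) (h6 : ∀ v ∈ l, 6 ≤ degIn G l.toFinset v)
    (w : ℕ) : ∀ W : Finset V, W.card = w → w ≤ 6 → (∀ x ∈ W, x ∉ l) →
    degSum G W + 2 * ∑ x ∈ W, degIn G l.toFinset x ≤ 8 * w := by
  induction w with
  | zero =>
    intro W hW _ _
    rw [Finset.card_eq_zero.1 hW]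
    simp [degSum]
  | succ w ih =>
    intro W hW hw hWl
    by_cases hx : ∃ x ∈ W, degIn G l.toFinset x + degIn G W x ≤ 4
    · obtain ⟨x, hx, hx4⟩ := hx
      have h1 := ih (W.erase x) (by rw [Finset.card_erase_of_mem hx]; omega) (by omega)
        fun y hy => hWl y (Finset.mem_of_mem_erase hy)
      have h2 := degSum_erase (G := G) hx
      have h3 := Finset.add_sum_erase W (fun x => degIn G l.toFinset x) hx
      omega
    · push Not at hx
      have hone : ∀ x ∈ W, ∃ y ∈ W, G.Adj x y := fun x hxW => by
        have h4 := hG.degIn_le_four hl h13 (hWl x hxW) h6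
        have := hx x hxW
        exact degIn_pos.1 (by omega)
      have htwo : ∀ x ∈ W, 2 ≤ degIn G W x := fun x hxW => by
        obtain ⟨y, hy, ha⟩ := hone x hxW
        have := hG.degIn_le_three hl h13 (hWl x hxW) (hWl y hy) ha
        have := hx x hxW
        omega
      have hle : ∀ x ∈ W, degIn G l.toFinset x ≤ 1 := fun x hxW => by
        obtain ⟨y, hy, ha⟩ := hone x hxW
        obtain ⟨z, hz, hyz, hzx⟩ : ∃ z ∈ W, G.Adj y z ∧ z ≠ x := by
          by_contra! hno
          have := degIn_le_of_imp (G := G) (U := W) (A := {x}) (v := y) fun z hz hyz => by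
            simpa using hno z hz hyz
          have := htwo y hy
          simp at *
          omega
        exact hG.degIn_le_one hl h13 (hWl x hxW) (hWl y hy) (hWl z hz) ha hyz hzx
      have h1 : ∑ x ∈ W, degIn G l.toFinset x ≤ _ := Finset.sum_le_card_nsmul _ _ _ hle
      have h2 := degSum_le_card (G := G) W
      rw [hW] at h1 h2
      simp only [smul_eq_mul, Nat.add_sub_cancel] at h1 h2
      have hw5 : w ≤ 5 := by omega
      interval_cases w <;> omega

theorem IsCore.degSum_le_of_card_thirteen (hG : NoTwoPaths G) (h : IsCore G U H)
    (hcon : ConnectedOn G U) (hH : H.card = 13) (hU : 14 ≤ U.card) :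
    degSum G U + 16 ≤ 10 * U.card ∧ (19 ≤ U.card → degSum G U + 28 ≤ 10 * U.card) := by
  obtain ⟨l, hl, hlH, h13⟩ := hG.exists_path_thirteen h.six_le (by omega)
  obtain rfl : l.toFinset = H := Finset.eq_of_subset_of_card_le
    (fun x hx => hlH x (List.mem_toFinset.1 hx)) (by rw [hl.card_toFinset]; omega)
  have h6 : ∀ v ∈ l, 6 ≤ degIn G l.toFinset v := fun v hv => h.six_le v (List.mem_toFinset.2 hv)
  have h114 := degSum_le_of_path_thirteen hl h13 (hcon.not_isHam hG h.subset hH hU) h6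
  have h1 := h.degSum_le h.subset subset_rfl
  refine ⟨by omega, fun h19 => ?_⟩
  obtain ⟨S, hHS, hSU, hS, hDS⟩ := h.exists_card (m := 19) (by omega) h19
  have hsum := degSum_union (G := G) (Finset.disjoint_sdiff (s := l.toFinset) (t := S))
  rw [Finset.union_sdiff_of_subset hHS] at hsum
  have := hG.degSum_add_le hl h13 h6 6 (S \ l.toFinset)
    (by rw [Finset.card_sdiff_of_subset hHS]; omega) le_rfl fun x hx => by
      simpa using (Finset.mem_sdiff.1 hx).2
  omega

end

section

variable {V : Type*} [DecidableEq V] {G : SimpleGraph V} {U H : Finset V}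

/-- A graph of minimum degree at least five without a path on seven vertices is `5`-regular. -/
theorem degIn_le_five_of_no_path (k : ℕ) : ∀ R : Finset V, R.card = k →
    (∀ l, IsPathList G l → (∀ x ∈ l, x ∈ R) → l.length < 7) → (∀ v ∈ R, 5 ≤ degIn G R v) →
    ∀ v ∈ R, degIn G R v ≤ 5 := by
  induction k using Nat.strong_induction_on with
  | _ k ih =>
    intro R hk hP h5 v hv
    rcases exists_long_path_or_closed_cycle ⟨v, hv⟩ h5 with
      ⟨l, h1, h2, h3⟩ | ⟨T, hTR, hT, h6, -, hcl⟩
    · have := hP l h1 h2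
      omega
    obtain ⟨l, hl, rfl, hlen⟩ := hT.exists_path
    have hl7 := hP l hl fun x hx => hTR (List.mem_toFinset.2 hx)
    by_cases hvT : v ∈ l.toFinset
    · have h1 : degIn G R v ≤ degIn G l.toFinset v := degIn_le_degIn_of_imp fun w hw ha => by
        by_contra hwT
        exact hcl v hvT w hw hwT ha
      have h2 := degIn_lt_card (G := G) hvT
      omega
    · have hc := Finset.card_sdiff_of_subset hTR
      have hle := Finset.card_le_card hTR
      refine (degIn_sdiff_of_closed hcl hv hvT).trans (ih (R \ l.toFinset).card (by omega) _ rfl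
        (fun m hm hmR => hP m hm fun x hx => (Finset.mem_sdiff.1 (hmR x hx)).1)
        (fun w hw => ?_) v (Finset.mem_sdiff.2 ⟨hv, hvT⟩))
      rw [Finset.mem_sdiff] at hw
      exact (h5 w hw.1).trans (degIn_sdiff_of_closed hcl hw.1 hw.2)

/-- The vertices off a path on thirteen vertices, in a graph of minimum degree at least six. -/
theorem NoTwoPaths.off_path_thirteen (hG : NoTwoPaths G) (h6 : ∀ v ∈ H, 6 ≤ degIn G H v)
    (hc : 14 ≤ H.card) {l : List V} (hl : IsPathList G l) (hlH : ∀ x ∈ l, x ∈ H)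
    (h13 : l.length = 13) :
    (∀ x ∈ H, x ∉ l → degIn G H x ≤ 6) ∧
      ∃ m, IsPathList G m ∧ (∀ x ∈ m, x ∈ H ∧ x ∉ l) ∧ m.length = 6 ∧
        ∀ x ∈ m, G.Adj l[6] x := by
  have hsub : l.toFinset ⊆ H := fun x hx => hlH x (List.mem_toFinset.1 hx)
  have hcl := hl.card_toFinset
  set R := H \ l.toFinset with hR
  have hRc : 1 ≤ R.card := by rw [hR, Finset.card_sdiff_of_subset hsub]; omega
  have hmem : ∀ {x}, x ∈ R → x ∈ H ∧ x ∉ l := fun {x} hx => by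
    rw [hR, Finset.mem_sdiff, List.mem_toFinset] at hx
    exact hx
  have hsplit : ∀ x, degIn G H x = degIn G l.toFinset x + degIn G R x := fun x => by
    rw [← degIn_union Finset.disjoint_sdiff, Finset.union_sdiff_of_subset hsub]
  have hone : ∀ x ∈ R, ∃ y ∈ R, G.Adj x y := fun x hx => by
    have h1 := hG.degIn_le_five hl h13 (hmem hx).2
    have h2 := h6 x (hmem hx).1
    rw [hsplit] at h2
    exact degIn_pos.1 (by omega)
  have hthree : ∀ x ∈ R, 3 ≤ degIn G R x := fun x hx => by
    obtain ⟨y, hy, ha⟩ := hone x hx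
    have h1 := hG.degIn_le_three hl h13 (hmem hx).2 (hmem hy).2 ha
    have h2 := h6 x (hmem hx).1
    rw [hsplit] at h2
    omega
  have hpos : ∀ x ∈ R, nbrPos G l x ⊆ {6} := fun x hx => by
    obtain ⟨y, hy, ha⟩ := hone x hx
    obtain ⟨z, hz, hyz, hzx⟩ : ∃ z ∈ R, G.Adj y z ∧ z ≠ x := by
      by_contra! hno
      have h1 := degIn_le_of_imp (G := G) (U := R) (A := {x}) (v := y) fun z hz hyz => by
        simpa using hno z hz hyz
      have h2 := hthree y hy
      rw [Finset.card_singleton] at h1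
      omega
    exact hG.nbrPos_subset hl h13 (hmem hx).2 (hmem hy).2 (hmem hz).2 ha hyz hzx
  have hle : ∀ x ∈ R, degIn G l.toFinset x ≤ 1 := fun x hx => by
    rw [← card_nbrPos hl.2]
    exact Finset.card_le_card (hpos x hx)
  have hfive : ∀ x ∈ R, 5 ≤ degIn G R x := fun x hx => by
    have h1 := hle x hx
    have h2 := h6 x (hmem hx).1
    rw [hsplit] at h2
    omega
  have hP : ∀ m, IsPathList G m → (∀ x ∈ m, x ∈ R) → m.length < 7 := fun m hm hmR => by
    by_contra! h7
    exact hG m l hm hl (fun a ha hb => (hmem (hmR a ha)).2 hb) h7 (by omega)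
  have hreg := degIn_le_five_of_no_path _ R rfl hP hfive
  refine ⟨fun x hx hxl => ?_, ?_⟩
  · have hxR : x ∈ R := by
      rw [hR, Finset.mem_sdiff, List.mem_toFinset]
      exact ⟨hx, hxl⟩
    have h1 := hle x hxR
    have h2 := hreg x hxR
    rw [hsplit]
    omega
  · obtain ⟨m, hm, hmR, hm6⟩ := exists_path_of_degIn (Finset.card_pos.1 hRc) hfive
    have h7 := hP m hm hmR
    refine ⟨m, hm, fun x hx => hmem (hmR x hx), by omega, fun x hx => ?_⟩
    have h1 := hreg x (hmR x hx)
    have h2 := h6 x (hmem (hmR x hx)).1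
    rw [hsplit, ← card_nbrPos hl.2] at h2
    obtain ⟨i, hi⟩ := Finset.card_pos.1 (show 0 < (nbrPos G l x).card by omega)
    have hi6 := Finset.mem_singleton.1 (hpos x (hmR x hx) hi)
    subst hi6
    exact (mem_nbrPos.1 hi).2.symm

theorem NoTwoPaths.degIn_drop_le_six (hG : NoTwoPaths G) (h6 : ∀ v ∈ H, 6 ≤ degIn G H v)
    (hc : 14 ≤ H.card) {l : List V} (hl : IsPathList G l) (hlH : ∀ x ∈ l, x ∈ H)
    (h13 : l.length = 13) : ∀ x ∈ l.drop 7, degIn G H x ≤ 6 := by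
  obtain ⟨-, m, hm, hmH, hm6, ha⟩ := hG.off_path_thirteen h6 hc hl hlH h13
  have hp : IsPathList G (l.take 7 ++ m) := by
    refine (hl.take 7).append hm (fun a ha hb => (hmH a hb).2 (List.mem_of_mem_take ha)) ?_
    intro a h1 b h2
    simp [List.getLast?_take, h13] at h1
    subst h1
    exact ha b (List.mem_of_mem_head? h2)
  intro x hx
  refine (hG.off_path_thirteen h6 hc hp ?_ (by simp; omega)).1 x
    (hlH x (List.mem_of_mem_drop hx)) fun h => ?_
  · intro y hy
    rcases List.mem_append.1 hy with h | h
    · exact hlH y (List.mem_of_mem_take h)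
    · exact (hmH y h).1
  · rcases List.mem_append.1 h with h | h
    · have := hl.2
      rw [← List.take_append_drop 7 l] at this
      exact (List.nodup_append'.1 this).2.2 h hx
    · exact (hmH x h).2 (List.mem_of_mem_drop hx)

theorem NoTwoPaths.degSum_le_of_six_le (hG : NoTwoPaths G) (h6 : ∀ v ∈ H, 6 ≤ degIn G H v)
    (hc : 14 ≤ H.card) : degSum G H ≤ 7 * (H.card - 1) := by
  obtain ⟨l, hl, hlH, h13⟩ := hG.exists_path_thirteen h6 (by omega)
  have h1 := (hG.off_path_thirteen h6 hc hl hlH h13).1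
  have h2 := hG.degIn_drop_le_six h6 hc hl hlH h13
  have h3 := hG.degIn_drop_le_six h6 hc hl.reverse (by simpa using hlH) (by simpa using h13)
  have hl6 : l[6] ∈ H := hlH _ (List.getElem_mem _)
  have hall : ∀ x ∈ H.erase l[6], degIn G H x ≤ 6 := by
    intro x hx
    rw [Finset.mem_erase] at hx
    by_cases hxl : x ∈ l
    · obtain ⟨i, hi, rfl⟩ := List.getElem_of_mem hxl
      have hne : i ≠ 6 := by rintro rfl; exact hx.1 rfl
      rcases Nat.lt_or_ge i 7 with h7 | h7
      · refine h3 _ ?_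
        rw [List.drop_reverse, List.mem_reverse, List.mem_take_iff_getElem]
        exact ⟨i, by omega, rfl⟩
      · refine h2 _ (List.mem_drop_iff_getElem.2 ⟨i - 7, by omega, ?_⟩)
        congr 1
        omega
    · exact h1 x hx.2 hxl
  have hs := Finset.add_sum_erase H (fun x => degIn G H x) hl6
  have hlt := degIn_lt_card (G := G) hl6
  have hb : ∑ x ∈ H.erase l[6], degIn G H x ≤ _ := Finset.sum_le_card_nsmul _ _ _ hall
  rw [Finset.card_erase_of_mem hl6, smul_eq_mul] at hb
  unfold degSum
  omega

end

section

variable {V : Type*} [DecidableEq V] {G : SimpleGraph V} {U H : Finset V}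

theorem sixBlocks_add_le (a b : ℕ) : sixBlocks a + sixBlocks b ≤ sixBlocks (a + b) := by
  unfold sixBlocks
  have ha : a % 6 < 6 := Nat.mod_lt _ (by norm_num)
  have hb : b % 6 < 6 := Nat.mod_lt _ (by norm_num)
  have hab : (a + b) % 6 = (a % 6 + b % 6) % 6 := Nat.add_mod a b 6
  have hdiv : (a + b) / 6 = a / 6 + b / 6 + (a % 6 + b % 6) / 6 := by omega
  rw [hab, hdiv]
  generalize a % 6 = r at *
  generalize b % 6 = s at *
  interval_cases r <;> interval_cases s <;> norm_num <;> omega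

theorem sixBlocks_le (b : ℕ) : sixBlocks b ≤ 5 * b := by
  unfold sixBlocks
  have hb : b % 6 < 6 := Nat.mod_lt _ (by norm_num)
  have := Nat.div_add_mod b 6
  generalize b % 6 = r at *
  interval_cases r <;> norm_num <;> omega

theorem sixBlocks_add_le_of_le_thirteen (c : ℕ) {d : ℕ} (hd : d ≤ 13) :
    (13 - d) * (13 - d - 1) + sixBlocks (c + d) ≤ 156 + sixBlocks c := by
  unfold sixBlocks
  have hc : c % 6 < 6 := Nat.mod_lt _ (by norm_num)
  have hcd : (c + d) % 6 = (c % 6 + d) % 6 := by omega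
  have hdiv : (c + d) / 6 = c / 6 + (c % 6 + d) / 6 := by omega
  rw [hcd, hdiv]
  generalize c % 6 = r at *
  interval_cases r <;> interval_cases d <;> norm_num <;> omega

/-- Twice the maximal number of edges of a graph on `k` vertices without two disjoint paths on
seven vertices. -/
def twoPathsBound (k : ℕ) : ℕ :=
  if k ≤ 13 then k * (k - 1) else max (156 + sixBlocks (k - 13)) (10 * k - 28)

theorem twoPathsBound_add_sixBlocks_le (a b : ℕ) (h : 14 ≤ a + b) :
    twoPathsBound a + sixBlocks b ≤ twoPathsBound (a + b) := by
  rw [twoPathsBound, twoPathsBound, if_neg (by omega : ¬ a + b ≤ 13)]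
  split_ifs with ha
  · refine le_trans ?_ (le_max_left _ _)
    have := sixBlocks_add_le_of_le_thirteen (a + b - 13) (d := 13 - a) (by omega)
    rw [show 13 - (13 - a) = a by omega, show a + b - 13 + (13 - a) = b by omega] at this
    exact this
  · have h1 := sixBlocks_add_le (a - 13) b
    have h2 := sixBlocks_le b
    rw [show a - 13 + b = a + b - 13 by omega] at h1
    omega

theorem twoPathsBound_bounds {k : ℕ} (hk : 14 ≤ k) :
    10 * k - 28 ≤ twoPathsBound k ∧ 6 * k + 60 ≤ twoPathsBound k ∧
      8 * k + 16 ≤ twoPathsBound k ∧ (k ≤ 15 → 10 * k ≤ twoPathsBound k) ∧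
      (k ≤ 18 → 10 * k ≤ twoPathsBound k + 16) := by
  rw [twoPathsBound, if_neg (by omega)]
  rcases Nat.lt_or_ge k 22 with h | h
  · interval_cases k <;> decide
  · have := le_max_right (156 + sixBlocks (k - 13)) (10 * k - 28)
    omega

theorem exists_closed_of_not_connectedOn (h : ¬ ConnectedOn G U) :
    ∃ X ⊆ U, X.Nonempty ∧ X ≠ U ∧ ∀ x ∈ X, ∀ y ∈ U, y ∉ X → ¬ G.Adj x y := by
  unfold ConnectedOn at h
  push Not at h
  exact h

variable [Finite V]

theorem NoTwoPaths.degSum_le_of_connectedOn (hG : NoTwoPaths G) (hcon : ConnectedOn G U)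
    (hU : 14 ≤ U.card) : degSum G U ≤ twoPathsBound U.card := by
  by_contra! hlt
  obtain ⟨hb1, hb2, hb3, hb4, hb5⟩ := twoPathsBound_bounds hU
  have hcyc : ¬ ∃ T ⊆ U, T.card = 12 ∧ IsHam G T := by
    rintro ⟨T, hTU, hc, hT⟩
    have := degSum_le_of_twelve_cycle hG hTU hcon hT hc hU
    omega
  have hD : 10 * U.card ≤ degSum G U + 27 := by omega
  obtain ⟨H, h⟩ := exists_isCore (G := G) U
  have hHU := Finset.card_le_card h.subset
  have hle := h.degSum_le h.subset subset_rfl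
  rcases H.eq_empty_or_nonempty with rfl | ⟨v, hv⟩
  · obtain ⟨S, -, -, hS, hDS⟩ := h.exists_card (m := 5) (by simp) (by omega)
    have := degSum_le_card (G := G) S
    rw [hS] at this
    omega
  have h7 : 7 ≤ H.card := by
    have := h.six_le v hv
    have := degIn_lt_card (G := G) hv
    omega
  rcases Nat.lt_or_ge 13 H.card with h14 | h13
  · have := hG.degSum_le_of_six_le h.six_le h14
    omega
  have hDH := degSum_le_card (G := G) H
  obtain hH | hH | hH | hH | hH | hH | hH : H.card = 7 ∨ H.card = 8 ∨ H.card = 9 ∨ H.card = 10 ∨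
    H.card = 11 ∨ H.card = 12 ∨ H.card = 13 := by omega
  · rw [hH] at hDH
    omega
  · exact hcyc (h.twelve_cycle_of_card_eight hH (by omega) hD)
  · exact hcyc (h.twelve_cycle_of_card_nine hH (by omega) hD)
  · exact hcyc (h.twelve_cycle_of_card_ten hH (by omega) hD)
  · rcases Nat.lt_or_ge U.card 16 with h16 | h16
    · rw [hH] at hDH
      omega
    · exact hcyc (h.twelve_cycle_of_card_eleven hG hH h16 hD)
  · exact hcyc ⟨H, h.subset, hH, h.isHam (by omega) (by omega)⟩
  · have := h.degSum_le_of_card_thirteen hG hcon hH hU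
    omega

theorem NoTwoPaths.degSum_le (hG : NoTwoPaths G) (k : ℕ) : ∀ U : Finset V, U.card = k →
    degSum G U ≤ twoPathsBound k := by
  induction k using Nat.strong_induction_on with
  | _ k ih =>
    intro U hk
    rcases Nat.lt_or_ge k 14 with h14 | h14
    · rw [twoPathsBound, if_pos (by omega), ← hk]
      exact degSum_le_card U
    by_cases hcon : ConnectedOn G U
    · rw [← hk]
      exact hG.degSum_le_of_connectedOn hcon (by omega)
    obtain ⟨X, hXU, hne, hXne, hcl⟩ := exists_closed_of_not_connectedOn hcon
    have hsum := degSum_sdiff_of_closed hXU hcl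
    have hc := Finset.card_sdiff_of_subset hXU
    have hX1 := Finset.card_pos.2 hne
    have hX2 := Finset.card_lt_card (Finset.ssubset_iff_subset_ne.2 ⟨hXU, hXne⟩)
    by_cases hP : ∀ l, IsPathList G l → (∀ x ∈ l, x ∈ X) → l.length < 7
    · have h1 := degSum_le_sixBlocks _ X rfl hP
      have h2 := ih (U \ X).card (by omega) _ rfl
      have h3 := twoPathsBound_add_sixBlocks_le (U \ X).card X.card (by omega)
      rw [show (U \ X).card + X.card = k by omega] at h3
      omega
    · push Not at hP
      obtain ⟨l, hl, hlX, hl7⟩ := hP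
      have h1 := degSum_le_sixBlocks (G := G) _ (U \ X) rfl fun m hm hmX => by
        by_contra! hm7
        exact hG l m hl hm (fun a ha hb => (Finset.mem_sdiff.1 (hmX a hb)).2 (hlX a ha)) hl7 hm7
      have h2 := ih X.card (by omega) _ rfl
      have h3 := twoPathsBound_add_sixBlocks_le X.card (U \ X).card (by omega)
      rw [show X.card + (U \ X).card = k by omega] at h3
      omega

end

section

variable {V : Type*} [DecidableEq V] {G : SimpleGraph V} {U H : Finset V}

theorem noTwoPaths_of_not_contains (h : ¬ Contains TwoP7 G) : NoTwoPaths G := by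
  intro l m hl hm hd hl7 hm7
  have hadj : ∀ {p : List V}, IsPathList G p → (h7 : 7 ≤ p.length) → ∀ i j : Fin 7,
      (pathGraph 7).Adj i j → G.Adj p[i.val] p[j.val] := by
    intro p hp h7 i j hij
    rw [pathGraph_adj] at hij
    rcases hij with hij | hij
    · have := List.isChain_iff_getElem.1 hp.1 i (by omega)
      simpa only [hij] using this
    · have := List.isChain_iff_getElem.1 hp.1 j (by omega)
      simpa only [hij] using this.symm
  have hne : ∀ i j : Fin 7, l[i.val] ≠ m[j.val] := fun i j hij =>
    hd (List.getElem_mem (by omega)) (hij.symm ▸ List.getElem_mem (by omega))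
  refine h ⟨⟨Sum.elim (fun i => l[i.val]) (fun i => m[i.val]), ?_⟩, ?_⟩
  · rintro (i | i) (j | j) hij
    · exact hadj hl hl7 i j hij
    · exact (Bool.false_ne_true hij).elim
    · exact (Bool.false_ne_true hij).elim
    · exact hadj hm hm7 i j hij
  · rintro (i | i) (j | j) hij
    · exact congrArg Sum.inl (Fin.ext ((hl.2.getElem_inj_iff).1 hij))
    · exact (hne i j hij).elim
    · exact (hne j i hij.symm).elim
    · exact congrArg Sum.inr (Fin.ext ((hm.2.getElem_inj_iff).1 hij))

theorem degSum_univ [Fintype V] : degSum G Finset.univ = 2 * G.edgeSet.ncard := by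
  classical
  rw [← coe_edgeFinset, Set.ncard_coe_finset, ← G.sum_degrees_eq_twice_card_edges]
  refine Finset.sum_congr rfl fun v _ => ?_
  rw [degIn, ← card_neighborFinset_eq_degree, neighborFinset_eq_filter]

theorem degSum_comap_val (G : SimpleGraph ℕ) (n : ℕ) :
    degSum (G.comap (Fin.val : Fin n → ℕ)) Finset.univ = degSum G (Finset.range n) := by
  classical
  simp only [degSum, degIn_eq_sum, Finset.sum_range, comap_adj]

theorem two_mul_bracket {n : ℕ} (hn : 14 ≤ n) :
    2 * max (bracket n 14 7) (5 * n - 14) = twoPathsBound n := by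
  have h : 2 * bracket n 14 7 = 156 + sixBlocks (n - 13) := by
    rw [bracket, if_neg (by omega), sixBlocks]
    have hr : (n - 13) % 6 < 6 := Nat.mod_lt _ (by norm_num)
    simp only [show 14 - 1 = 13 from rfl, show 7 - 1 = 6 from rfl,
      show Nat.choose 13 2 = 78 from rfl, show Nat.choose 6 2 = 15 from rfl]
    generalize (n - 13) % 6 = r at *
    interval_cases r <;> simp [Nat.choose] <;> omega
  rw [twoPathsBound, if_neg (by omega)]
  omega

/-- A clique on `13` vertices together with disjoint cliques on `6` vertices. -/
def cliqueBlocks : SimpleGraph ℕ where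
  Adj i j := i ≠ j ∧ (i < 13 ∧ j < 13 ∨ 13 ≤ i ∧ 13 ≤ j ∧ (i - 13) / 6 = (j - 13) / 6)
  symm := ⟨by intro i j; omega⟩
  loopless := ⟨by intro i; omega⟩

/-- Five vertices joined to everything, together with one further edge. -/
def fiveJoin : SimpleGraph ℕ where
  Adj i j := i ≠ j ∧ (i < 5 ∨ j < 5 ∨ i = 5 ∧ j = 6 ∨ i = 6 ∧ j = 5)
  symm := ⟨by intro i j; omega⟩
  loopless := ⟨by intro i; omega⟩

theorem degIn_ge_of_imp {A : Finset V} {v : V} (hA : A ⊆ U) (h : ∀ w ∈ A, G.Adj v w) :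
    A.card ≤ degIn G U v := by
  classical
  exact Finset.card_le_card fun w hw => Finset.mem_filter.2 ⟨hA hw, h w hw⟩

theorem degSum_range_succ (G : SimpleGraph ℕ) (n : ℕ) :
    degSum G (Finset.range (n + 1)) = degSum G (Finset.range n) +
      2 * degIn G (Finset.range n) n := by
  rw [Finset.range_add_one, degSum_insert (by simp)]

theorem cliqueBlocks_degSum (k : ℕ) :
    156 + sixBlocks k ≤ degSum cliqueBlocks (Finset.range (k + 13)) := by
  induction k with
  | zero =>
    have h : ∀ j ≤ 13, j * (j - 1) ≤ degSum cliqueBlocks (Finset.range j) := by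
      intro j
      induction j with
      | zero => simp
      | succ j ih =>
        intro hj
        have h1 := ih (by omega)
        have h2 := degIn_ge_of_imp (G := cliqueBlocks) (U := Finset.range j) (A := Finset.range j)
          (v := j) subset_rfl fun w hw => by
            rw [Finset.mem_range] at hw
            exact ⟨by omega, by omega⟩
        rw [Finset.card_range] at h2
        rw [degSum_range_succ]
        have hj' : j ≤ 12 := by omega
        interval_cases j <;> omega
    exact h 13 le_rfl
  | succ k ih =>
    have h2 := degIn_ge_of_imp (G := cliqueBlocks) (U := Finset.range (k + 13))
      (A := Finset.Ico (k + 13 - k % 6) (k + 13)) (v := k + 13)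
      (fun w hw => by simp at hw ⊢; omega) fun w hw => by
        rw [Finset.mem_Ico] at hw
        refine ⟨by omega, Or.inr ⟨by omega, by omega, ?_⟩⟩
        omega
    rw [Nat.card_Ico] at h2
    rw [show k + 1 + 13 = k + 13 + 1 by ring, degSum_range_succ]
    have h3 : sixBlocks (k + 1) ≤ sixBlocks k + 2 * (k % 6) := by
      unfold sixBlocks
      have hc : k % 6 < 6 := Nat.mod_lt _ (by norm_num)
      have hcd : (k + 1) % 6 = (k % 6 + 1) % 6 := by omega
      have hdiv : (k + 1) / 6 = k / 6 + (k % 6 + 1) / 6 := by omega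
      rw [hcd, hdiv]
      generalize k % 6 = r at *
      interval_cases r <;> omega
    have h4 := Nat.mod_le k 6
    omega

theorem fiveJoin_degSum (k : ℕ) :
    10 * k + 42 ≤ degSum fiveJoin (Finset.range (k + 7)) := by
  induction k with
  | zero =>
    have h : ∀ j ≤ 7, j * (j - 1) ≤ degSum fiveJoin (Finset.range j) := by
      intro j
      induction j with
      | zero => simp
      | succ j ih =>
        intro hj
        have h1 := ih (by omega)
        have h2 := degIn_ge_of_imp (G := fiveJoin) (U := Finset.range j) (A := Finset.range j)
          (v := j) subset_rfl fun w hw => by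
            rw [Finset.mem_range] at hw
            exact ⟨by omega, by omega⟩
        rw [Finset.card_range] at h2
        rw [degSum_range_succ]
        have hj' : j ≤ 6 := by omega
        interval_cases j <;> omega
    exact h 7 le_rfl
  | succ k ih =>
    have h2 := degIn_ge_of_imp (G := fiveJoin) (U := Finset.range (k + 7))
      (A := Finset.range 5) (v := k + 7) (fun w hw => by simp at hw ⊢; omega) fun w hw => by
        rw [Finset.mem_range] at hw
        exact ⟨by omega, by omega⟩
    rw [Finset.card_range] at h2
    rw [show k + 1 + 7 = k + 7 + 1 by ring, degSum_range_succ]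
    omega

theorem pathGraph_adj_succ (i : Fin 6) : (pathGraph 7).Adj i.castSucc i.succ := by
  rw [pathGraph_adj]
  simp

theorem cliqueBlocks_path {a : Fin 7 → ℕ} (ha : Function.Injective a)
    (h : ∀ i : Fin 6, cliqueBlocks.Adj (a i.castSucc) (a i.succ)) (i : Fin 7) : a i < 13 := by
  have hstep : ∀ i : Fin 7, (a 0 < 13 ∧ a i < 13) ∨
      (13 ≤ a 0 ∧ 13 ≤ a i ∧ (a i - 13) / 6 = (a 0 - 13) / 6) := by
    intro i
    induction i using Fin.induction with
    | zero => omega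
    | succ i ih =>
      have := (h i).2
      omega
  by_contra! hi
  have h0 : 13 ≤ a 0 := by have := hstep i; omega
  have hsub : Finset.univ.image a ⊆
      Finset.Ico (13 + 6 * ((a 0 - 13) / 6)) (13 + 6 * ((a 0 - 13) / 6) + 6) := by
    intro v hv
    obtain ⟨j, -, rfl⟩ := Finset.mem_image.1 hv
    have := hstep j
    rw [Finset.mem_Ico]
    omega
  have := Finset.card_le_card hsub
  rw [Finset.card_image_of_injective _ ha, Nat.card_Ico] at this
  simp at this

theorem fiveJoin_path {a : Fin 7 → ℕ} (ha : Function.Injective a)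
    (h : ∀ i : Fin 6, fiveJoin.Adj (a i.castSucc) (a i.succ)) :
    3 ≤ (Finset.univ.filter fun i => a i < 5).card := by
  have hex : ∀ i : Fin 6, ¬ (a i.castSucc < 5 ∨ a i.succ < 5) →
      ∀ j : Fin 6, j ≠ i → a j.castSucc < 5 ∨ a j.succ < 5 := by
    intro i hi j hj
    by_contra hj'
    have h1 := (h i).2
    have h2 := (h j).2
    have h3 : a i.castSucc = a j.castSucc ∨ a i.castSucc = a j.succ ∧ a i.succ = a j.castSucc := by
      omega
    rcases h3 with h3 | ⟨h3, h4⟩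
    · exact hj (Fin.castSucc_injective _ (ha h3)).symm
    · have e1 := congrArg Fin.val (ha h3)
      have e2 := congrArg Fin.val (ha h4)
      simp at e1 e2
      omega
  rw [Finset.card_filter, Fin.sum_univ_seven]
  have hpair : ∀ i j : Fin 7, (a i < 5 ∨ a j < 5) →
      1 ≤ (if a i < 5 then 1 else 0) + (if a j < 5 then 1 else 0) := by
    intro i j hij
    rcases hij with hij | hij <;> simp [hij]
  by_cases hM : ∀ i ∈ ({0, 2, 4} : Finset (Fin 6)), a i.castSucc < 5 ∨ a i.succ < 5
  · have h1 := hpair 0 1 (hM 0 (by simp))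
    have h2 := hpair 2 3 (hM 2 (by simp))
    have h3 := hpair 4 5 (hM 4 (by simp))
    omega
  · push Not at hM
    obtain ⟨i, hi, hi'⟩ := hM
    have hc := hex i (by omega)
    have h1 := hpair 1 2 (hc 1 (by rintro rfl; simp at hi))
    have h2 := hpair 3 4 (hc 3 (by rintro rfl; simp at hi))
    have h3 := hpair 5 6 (hc 5 (by rintro rfl; simp at hi))
    omega

theorem not_contains_comap_val {K : SimpleGraph ℕ} {n : ℕ}
    (h : ∀ a b : Fin 7 → ℕ, Function.Injective a → Function.Injective b → (∀ i j, a i ≠ b j) →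
      (∀ i : Fin 6, K.Adj (a i.castSucc) (a i.succ)) →
      (∀ i : Fin 6, K.Adj (b i.castSucc) (b i.succ)) → False) :
    ¬ Contains TwoP7 (K.comap (Fin.val : Fin n → ℕ)) := by
  rintro ⟨f, hf⟩
  have hf' := Fin.val_injective.comp hf
  refine h (fun i => f (Sum.inl i)) (fun i => f (Sum.inr i)) (hf'.comp Sum.inl_injective)
    (hf'.comp Sum.inr_injective) (fun i j hij => ?_) (fun i => ?_) fun i => ?_
  · exact Sum.inl_ne_inr (hf' hij)
  · exact f.map_rel (show TwoP7.Adj (Sum.inl i.castSucc) (Sum.inl i.succ) from pathGraph_adj_succ i)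
  · exact f.map_rel (show TwoP7.Adj (Sum.inr i.castSucc) (Sum.inr i.succ) from pathGraph_adj_succ i)

theorem not_contains_cliqueBlocks (n : ℕ) :
    ¬ Contains TwoP7 (cliqueBlocks.comap (Fin.val : Fin n → ℕ)) := by
  refine not_contains_comap_val fun a b ha hb hab h1 h2 => ?_
  have hsub : Finset.univ.image a ∪ Finset.univ.image b ⊆ Finset.range 13 := by
    intro v hv
    rw [Finset.mem_range]
    rcases Finset.mem_union.1 hv with hv | hv
    · obtain ⟨i, -, rfl⟩ := Finset.mem_image.1 hv
      exact cliqueBlocks_path ha h1 i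
    · obtain ⟨i, -, rfl⟩ := Finset.mem_image.1 hv
      exact cliqueBlocks_path hb h2 i
  have := Finset.card_le_card hsub
  rw [Finset.card_union_of_disjoint, Finset.card_image_of_injective _ ha,
    Finset.card_image_of_injective _ hb] at this
  · simp at this
  · rw [Finset.disjoint_left]
    intro v hv hv'
    obtain ⟨i, -, rfl⟩ := Finset.mem_image.1 hv
    obtain ⟨j, -, hj⟩ := Finset.mem_image.1 hv'
    exact hab i j hj.symm

theorem not_contains_fiveJoin (n : ℕ) :
    ¬ Contains TwoP7 (fiveJoin.comap (Fin.val : Fin n → ℕ)) := by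
  refine not_contains_comap_val fun a b ha hb hab h1 h2 => ?_
  have hsub : (Finset.univ.filter fun i => a i < 5).image a ∪
      (Finset.univ.filter fun i => b i < 5).image b ⊆ Finset.range 5 := by
    intro v hv
    rw [Finset.mem_range]
    rcases Finset.mem_union.1 hv with hv | hv
    · obtain ⟨i, hi, rfl⟩ := Finset.mem_image.1 hv
      exact (Finset.mem_filter.1 hi).2
    · obtain ⟨i, hi, rfl⟩ := Finset.mem_image.1 hv
      exact (Finset.mem_filter.1 hi).2
  have := Finset.card_le_card hsub
  have h3 := fiveJoin_path ha h1
  have h4 := fiveJoin_path hb h2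
  rw [Finset.card_union_of_disjoint, Finset.card_image_of_injective _ ha,
    Finset.card_image_of_injective _ hb, Finset.card_range] at this
  · omega
  · rw [Finset.disjoint_left]
    intro v hv hv'
    obtain ⟨i, -, rfl⟩ := Finset.mem_image.1 hv
    obtain ⟨j, -, hj⟩ := Finset.mem_image.1 hv'
    exact hab i j hj.symm

theorem ncard_edgeSet_le {n : ℕ} {G : SimpleGraph (Fin n)} (h : ¬ Contains TwoP7 G) :
    2 * G.edgeSet.ncard ≤ twoPathsBound n := by
  rw [← degSum_univ]
  exact (noTwoPaths_of_not_contains h).degSum_le n Finset.univ (by simp)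

end

/-- For every `n ≥ 14`, `ex(n, 2P₇) = max {[n,14,7], 5n - 14}`: this value is the
greatest element of the set of edge counts of `2P₇`-free graphs on `n` vertices. -/
theorem stmt0 (n : ℕ) (hn : 14 ≤ n) :
    IsGreatest {m : ℕ | ∃ G : SimpleGraph (Fin n), ¬ Contains TwoP7 G ∧ G.edgeSet.ncard = m}
      (max (bracket n 14 7) (5 * n - 14)) := by
  have hmax := two_mul_bracket hn
  constructor
  · have hval : twoPathsBound n = max (156 + sixBlocks (n - 13)) (10 * n - 28) := by
      rw [twoPathsBound, if_neg (by omega)]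
    have hclique := cliqueBlocks_degSum (n - 13)
    have hjoin := fiveJoin_degSum (n - 7)
    rw [show n - 13 + 13 = n by omega, ← degSum_comap_val, degSum_univ] at hclique
    rw [show n - 7 + 7 = n by omega, ← degSum_comap_val, degSum_univ] at hjoin
    have h1 := ncard_edgeSet_le (not_contains_cliqueBlocks n)
    have h2 := ncard_edgeSet_le (not_contains_fiveJoin n)
    rcases le_total (156 + sixBlocks (n - 13)) (10 * n - 28) with hle | hle
    · exact ⟨_, not_contains_fiveJoin n, by omega⟩
    · exact ⟨_, not_contains_cliqueBlocks n, by omega⟩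
  · rintro m ⟨G, hG, rfl⟩
    have := ncard_edgeSet_le hG
    omega
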